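/- Let 𝕜 be an algebraically closed field of arbitrary characteristic, and let n ≥ 1 and d ≥ 1 be integers. Then for every integer q with 2 ≤ q ≤ n + 1 and every integer p with 0 ≤ p and n!·p ≤ d^{q−1}, the Koszul cohomology group K_{p,q}(ℙ^n, O_{ℙ^n}(d)) vanishes; concretely, the Koszul-type complex ⋀^{p+1}V ⊗ R_{q−1} → ⋀^{p}V ⊗ R_q → ⋀^{p−1}V ⊗ R_{q+1} is exact at the middle term, i.e. the image of δ_{p+1,q−1} equals the kernel of δ_{p,q}. -/

import Mathlib

/-!
Asymptotic vanishing of syzygies of Veronese embeddings: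
`K_{p,q}(ℙ^n, O_{ℙ^n}(d)) = 0` for `2 ≤ q ≤ n + 1` and `0 ≤ p` with `n!·p ≤ d^{q-1}`.
-/

open MvPolynomial TensorProduct

noncomputable section

/-- The family `v : Fin p → α` with its `i`-th entry omitted. -/
def omitFun {α : Type*} {p : ℕ} (v : Fin p → α) (i : Fin p) : Fin (p - 1) → α := fun j =>
  if (j : ℕ) < (i : ℕ) then v ⟨j, lt_of_lt_of_le j.isLt (Nat.sub_le p 1)⟩
  else v ⟨(j : ℕ) + 1, Nat.add_lt_of_lt_sub j.isLt⟩

/-- The homogeneous component of degree `c ∈ ℤ` of a graded polynomial ring, where the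
variable `x` has degree `w x`.  It is `0` if `c` is not attained (e.g. if `c < 0`). -/
def component (𝕜 : Type*) [Field 𝕜] {σ M : Type*} [AddCommMonoid M] (w : σ → M) (c : M) :
    Submodule 𝕜 (MvPolynomial σ 𝕜) :=
  weightedHomogeneousSubmodule 𝕜 w c

/-- Multiplication `T_{c₁} × T_{c₂} → T_{c₃}` between homogeneous components,
when `c₁ + c₂ = c₃`. -/
def componentMul (𝕜 : Type*) [Field 𝕜] {σ M : Type*} [AddCommMonoid M] (w : σ → M)
    {c₁ c₂ c₃ : M} (h : c₁ + c₂ = c₃)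
    (v : component 𝕜 w c₁) (f : component 𝕜 w c₂) : component 𝕜 w c₃ :=
  ⟨(v : MvPolynomial σ 𝕜) * (f : MvPolynomial σ 𝕜), by
    have hv : IsWeightedHomogeneous w (v : MvPolynomial σ 𝕜) c₁ :=
      (mem_weightedHomogeneousSubmodule _ _ _ _).1 v.2
    have hf : IsWeightedHomogeneous w (f : MvPolynomial σ 𝕜) c₂ :=
      (mem_weightedHomogeneousSubmodule _ _ _ _).1 f.2
    exact (mem_weightedHomogeneousSubmodule _ _ _ _).2 (h ▸ hv.mul hf)⟩

/-- The element `v 0 ∧ v 1 ∧ ⋯ ∧ v (p-1)` of the `p`-th exterior power `⋀^p M`. -/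
def wedge (𝕜 : Type*) [Field 𝕜] {M : Type*} [AddCommGroup M] [Module 𝕜 M] (p : ℕ)
    (v : Fin p → M) : ⋀[𝕜]^p M :=
  ⟨ExteriorAlgebra.ιMulti 𝕜 p v, ExteriorAlgebra.ιMulti_range 𝕜 p (Set.mem_range_self v)⟩

namespace VeroneseSyzygies

section Koszul

variable {k V J R : Type*} [Field k] [AddCommGroup V] [Module k V] [CommRing R] [Algebra k R]

/-- The `p`-th exterior power of `V` inside the exterior algebra, for `p ∈ ℤ`;
it is zero if `p < 0`. -/
def extPiece (k V : Type*) [Field k] [AddCommGroup V] [Module k V] (p : ℤ) :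
    Submodule k (ExteriorAlgebra k V) :=
  if 0 ≤ p then ⋀[k]^p.toNat V else ⊥

theorem extPiece_of_neg {p : ℤ} (hp : p < 0) : extPiece k V p = ⊥ := if_neg (by omega)

theorem extPiece_natCast (p : ℕ) : extPiece k V (p : ℤ) = ⋀[k]^p V := by
  simp [extPiece]

theorem extPiece_zero : extPiece k V 0 = 1 := by
  simp [extPiece]

theorem extPiece_succ {p : ℤ} (hp : 0 ≤ p) :
    extPiece k V (p + 1) = LinearMap.range (ExteriorAlgebra.ι k) * extPiece k V p := by
  lift p to ℕ using hp
  have : ((p : ℤ) + 1) = ((p + 1 : ℕ) : ℤ) := by push_cast; rfl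
  rw [this, extPiece_natCast, extPiece_natCast]
  exact pow_succ' _ _

theorem ι_mul_mem_extPiece (v : V) {p : ℤ} {x : ExteriorAlgebra k V} (hx : x ∈ extPiece k V p) :
    ExteriorAlgebra.ι k v * x ∈ extPiece k V (p + 1) := by
  rcases lt_or_ge p 0 with hp | hp
  · rw [extPiece_of_neg hp, Submodule.mem_bot] at hx
    simp [hx]
  · rw [extPiece_succ hp]
    exact Submodule.mul_mem_mul ⟨v, rfl⟩ hx

theorem contractLeft_mem_extPiece (u : Module.Dual k V) {p : ℤ} {x : ExteriorAlgebra k V}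
    (hx : x ∈ extPiece k V p) :
    CliffordAlgebra.contractLeft u x ∈ extPiece k V (p - 1) := by
  rcases lt_or_ge p 0 with hp | hp
  · rw [extPiece_of_neg hp, Submodule.mem_bot] at hx
    simp [hx]
  · lift p to ℕ using hp
    induction p generalizing x with
    | zero =>
      rw [Nat.cast_zero, extPiece_zero, Submodule.mem_one] at hx
      obtain ⟨r, rfl⟩ := hx
      have := CliffordAlgebra.contractLeft_algebraMap (Q := (0 : QuadraticForm k V)) (d := u) r
      rw [this]
      exact zero_mem _
    | succ p ih =>
      have h1 : ((p + 1 : ℕ) : ℤ) = (p : ℤ) + 1 := by push_cast; rfl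
      rw [h1, extPiece_succ (by positivity)] at hx
      rw [h1, add_sub_cancel_right]
      induction hx using Submodule.mul_induction_on' with
      | mem_mul_mem m hm y hy =>
        obtain ⟨v, rfl⟩ := hm
        have := CliffordAlgebra.contractLeft_ι_mul (Q := (0 : QuadraticForm k V)) (d := u) v y
        rw [show ExteriorAlgebra.ι k v * y =
          CliffordAlgebra.ι (0 : QuadraticForm k V) v * y from rfl, this]
        refine sub_mem (Submodule.smul_mem _ _ hy) ?_
        have := ι_mul_mem_extPiece v (ih hy)
        rwa [sub_add_cancel] at this
      | add x _ y _ hx hy => rw [map_add]; exact add_mem hx hy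

/-- The coefficients of the Koszul complex with values in `R`. -/
abbrev KoszulSpace (k R V : Type*) [Field k] [AddCommGroup V] [Module k V] [CommRing R]
    [Algebra k R] : Type _ := R ⊗[k] ExteriorAlgebra k V

/-- The elements of exterior degree `p` with coefficients in the subspace `S ⊆ R`. -/
def gr (p : ℤ) (S : Submodule k R) : Submodule k (KoszulSpace k R V) :=
  Submodule.map₂ (TensorProduct.mk k R (ExteriorAlgebra k V)) S (extPiece k V p)

theorem tmul_mem_gr {p : ℤ} {S : Submodule k R} {r : R} {x : ExteriorAlgebra k V} (hr : r ∈ S)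
    (hx : x ∈ extPiece k V p) : r ⊗ₜ[k] x ∈ gr (V := V) p S :=
  Submodule.apply_mem_map₂ _ hr hx

theorem gr_le {p : ℤ} {S : Submodule k R} {N : Submodule k (KoszulSpace k R V)} :
    gr p S ≤ N ↔ ∀ r ∈ S, ∀ x ∈ extPiece k V p, r ⊗ₜ[k] x ∈ N :=
  Submodule.map₂_le

theorem gr_mono {p : ℤ} {S S' : Submodule k R} (h : S ≤ S') : gr (V := V) p S ≤ gr p S' :=
  Submodule.map₂_le_map₂ h le_rfl

theorem gr_of_neg {p : ℤ} (hp : p < 0) (S : Submodule k R) : gr (V := V) p S = ⊥ := by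
  rw [gr, extPiece_of_neg hp, Submodule.map₂_bot_right]

theorem smul_mem_gr {p : ℤ} {S S' : Submodule k R} {r : R} (h : ∀ s ∈ S, r * s ∈ S')
    {x : KoszulSpace k R V} (hx : x ∈ gr p S) : r • x ∈ gr p S' := by
  have : gr p S ≤ (gr (V := V) p S').comap
      ((LinearMap.lsmul R (KoszulSpace k R V) r).restrictScalars k) :=
    gr_le.2 fun s hs y hy => by
      simp only [Submodule.mem_comap]
      exact tmul_mem_gr (h s hs) hy
  exact this hx

theorem rTensor_mem_gr {R' : Type*} [CommRing R'] [Algebra k R'] (ψ : R →ₗ[k] R') {p : ℤ}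
    {S : Submodule k R} {S' : Submodule k R'} (h : ∀ s ∈ S, ψ s ∈ S') {x : KoszulSpace k R V}
    (hx : x ∈ gr p S) : ψ.rTensor (ExteriorAlgebra k V) x ∈ gr (V := V) p S' := by
  have : gr p S ≤ (gr (V := V) p S').comap (ψ.rTensor (ExteriorAlgebra k V)) :=
    gr_le.2 fun s hs y hy => tmul_mem_gr (h s hs) hy
  exact this hx

theorem rTensor_eq_of_mem_gr {R' : Type*} [CommRing R'] [Algebra k R'] {ψ ψ' : R →ₗ[k] R'} {p : ℤ}
    {S : Submodule k R} (h : ∀ s ∈ S, ψ s = ψ' s) {x : KoszulSpace k R V} (hx : x ∈ gr p S) :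
    ψ.rTensor (ExteriorAlgebra k V) x = ψ'.rTensor (ExteriorAlgebra k V) x := by
  have : gr p S ≤ LinearMap.eqLocus (ψ.rTensor (ExteriorAlgebra k V))
      (ψ'.rTensor (ExteriorAlgebra k V)) :=
    gr_le.2 fun s hs y hy => by simp [LinearMap.mem_eqLocus, h s hs]
  exact this hx

variable [Fintype J] (b : Module.Basis J k V)

/-- Contraction with the functional that takes the value `u i` at the basis vector `b i`. -/
def contr (u : J → R) : KoszulSpace k R V →ₗ[R] KoszulSpace k R V :=
  ∑ i, u i • (CliffordAlgebra.contractLeft (Q := (0 : QuadraticForm k V)) (b.coord i)).baseChange R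

/-- The vector with coordinates `c`. -/
def vec (c : J → R) : KoszulSpace k R V := ∑ i, c i ⊗ₜ[k] ExteriorAlgebra.ι k (b i)

theorem contr_tmul (u : J → R) (r : R) (x : ExteriorAlgebra k V) :
    contr b u (r ⊗ₜ[k] x) = ∑ i, (u i * r) ⊗ₜ[k]
      (CliffordAlgebra.contractLeft (Q := (0 : QuadraticForm k V)) (b.coord i) x) := by
  simp [contr, LinearMap.sum_apply, TensorProduct.smul_tmul']

theorem contr_one (u : J → R) : contr b u 1 = 0 := by
  rw [Algebra.TensorProduct.one_def, contr_tmul]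
  exact Finset.sum_eq_zero fun i _ => by
    have := CliffordAlgebra.contractLeft_one (Q := (0 : QuadraticForm k V)) (d := b.coord i)
    rw [this, TensorProduct.tmul_zero]

theorem contr_vec_mul (u c : J → R) (x : KoszulSpace k R V) :
    contr b u (vec b c * x) = (∑ i, u i * c i) • x - vec b c * contr b u x := by
  classical
  induction x using TensorProduct.induction_on with
  | zero => simp
  | add x y hx hy => rw [mul_add, map_add, hx, hy, map_add, smul_add, mul_add]; abel
  | tmul r x =>
    rw [contr_tmul, vec, Finset.sum_mul, map_sum, Finset.sum_smul, Finset.sum_mul,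
      ← Finset.sum_sub_distrib]
    refine Finset.sum_congr rfl fun i _ => ?_
    rw [Algebra.TensorProduct.tmul_mul_tmul, contr_tmul, Finset.mul_sum]
    have h : ∀ j, CliffordAlgebra.contractLeft (Q := (0 : QuadraticForm k V)) (b.coord j)
        (ExteriorAlgebra.ι k (b i) * x) = (if i = j then x else 0) - ExteriorAlgebra.ι k (b i) *
          CliffordAlgebra.contractLeft (Q := (0 : QuadraticForm k V)) (b.coord j) x := by
      intro j
      rw [show ExteriorAlgebra.ι k (b i) * x = CliffordAlgebra.ι (0 : QuadraticForm k V) (b i) * x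
        from rfl, CliffordAlgebra.contractLeft_ι_mul]
      congr 1
      rw [Module.Basis.coord_apply, Module.Basis.repr_self, Finsupp.single_apply, ite_smul,
        one_smul, zero_smul]
    simp only [h, TensorProduct.tmul_sub, Finset.sum_sub_distrib]
    congr 1
    · rw [Finset.sum_eq_single i]
      · simp [TensorProduct.smul_tmul', mul_assoc]
      · intro j _ hj
        simp [hj.symm]
      · simp
    · refine Finset.sum_congr rfl fun j _ => ?_
      rw [Algebra.TensorProduct.tmul_mul_tmul]
      congr 1
      ring

theorem vec_single [DecidableEq J] (i : J) :
    vec b (Pi.single i (1 : R)) = 1 ⊗ₜ[k] ExteriorAlgebra.ι k (b i) := by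
  rw [vec, Finset.sum_eq_single i]
  · simp
  · intro j _ hj
    simp [hj]
  · simp

theorem one_tmul_ι (v : V) : (1 : R) ⊗ₜ[k] ExteriorAlgebra.ι k v =
    vec b (fun i => algebraMap k R (b.repr v i)) := by
  conv_lhs => rw [← b.sum_repr v]
  simp [-Module.Basis.sum_repr, vec, map_sum, TensorProduct.tmul_sum,
    Algebra.algebraMap_eq_smul_one, TensorProduct.smul_tmul]

theorem vec_add (c c' : J → R) : vec b (c + c') = vec b c + vec b c' := by
  simp [vec, TensorProduct.add_tmul, Finset.sum_add_distrib]

theorem vec_smul (r : R) (c : J → R) : vec b (r • c) = r • vec b c := by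
  simp [vec, Finset.smul_sum, TensorProduct.smul_tmul']

theorem ι_mul_ι_anticomm (v w : V) : ExteriorAlgebra.ι k v * ExteriorAlgebra.ι k w =
    -(ExteriorAlgebra.ι k w * ExteriorAlgebra.ι k v) :=
  eq_neg_of_add_eq_zero_left (ExteriorAlgebra.ι_add_mul_swap v w)

theorem vec_mul_vec (c c' : J → R) : vec b c * vec b c' = -(vec b c' * vec b c) := by
  rw [vec, vec, Finset.sum_mul_sum, Finset.sum_mul_sum, Finset.sum_comm, ← Finset.sum_neg_distrib]
  refine Finset.sum_congr rfl fun i _ => ?_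
  rw [← Finset.sum_neg_distrib]
  refine Finset.sum_congr rfl fun j _ => ?_
  rw [Algebra.TensorProduct.tmul_mul_tmul, Algebra.TensorProduct.tmul_mul_tmul, ι_mul_ι_anticomm,
    TensorProduct.tmul_neg, mul_comm]

theorem vec_mul_self (c : J → R) : vec b c * vec b c = 0 := by
  classical
  suffices h : ∀ s : Finset J, (∑ i ∈ s, c i ⊗ₜ[k] ExteriorAlgebra.ι k (b i)) *
      (∑ i ∈ s, c i ⊗ₜ[k] ExteriorAlgebra.ι k (b i)) = 0 from h _
  intro s
  induction s using Finset.induction_on with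
  | empty => simp
  | insert i s hi ih =>
    rw [Finset.sum_insert hi, add_mul, mul_add, mul_add, ih, add_zero,
      Algebra.TensorProduct.tmul_mul_tmul, ExteriorAlgebra.ι_sq_zero, TensorProduct.tmul_zero,
      zero_add, Finset.sum_mul, Finset.mul_sum, ← Finset.sum_add_distrib]
    refine Finset.sum_eq_zero fun j _ => ?_
    rw [Algebra.TensorProduct.tmul_mul_tmul, Algebra.TensorProduct.tmul_mul_tmul, ι_mul_ι_anticomm,
      TensorProduct.tmul_neg, mul_comm, neg_add_cancel]

theorem koszul_induction {P : KoszulSpace k R V → Prop} (h1 : P 1)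
    (hadd : ∀ x y, P x → P y → P (x + y)) (hsmul : ∀ (r : R) x, P x → P (r • x))
    (hvec : ∀ (c : J → R) x, P x → P (vec b c * x)) (x : KoszulSpace k R V) : P x := by
  have h0 : P 0 := by simpa using hsmul 0 1 h1
  induction x using TensorProduct.induction_on with
  | zero => exact h0
  | add x y hx hy => exact hadd x y hx hy
  | tmul r x =>
    rw [show r ⊗ₜ[k] x = r • ((1 : R) ⊗ₜ[k] x) by simp [TensorProduct.smul_tmul']]
    apply hsmul
    induction x using CliffordAlgebra.left_induction with
    | algebraMap a =>
      have : (1 : R) ⊗ₜ[k] algebraMap k (CliffordAlgebra (0 : QuadraticForm k V)) a =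
          algebraMap k R a • (1 : KoszulSpace k R V) := by
        rw [Algebra.algebraMap_eq_smul_one, Algebra.algebraMap_eq_smul_one, smul_assoc, one_smul,
          TensorProduct.tmul_smul, Algebra.TensorProduct.one_def]
      rw [this]
      exact hsmul _ _ h1
    | add x y hx hy =>
      rw [TensorProduct.tmul_add]
      exact hadd _ _ hx hy
    | ι_mul x v hx =>
      have : (1 : R) ⊗ₜ[k] (CliffordAlgebra.ι (0 : QuadraticForm k V) v * x) =
          vec b (fun i => algebraMap k R (b.repr v i)) * ((1 : R) ⊗ₜ[k] x) := by
        rw [← one_tmul_ι, Algebra.TensorProduct.tmul_mul_tmul, one_mul]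
      rw [this]
      exact hvec _ _ hx

theorem contr_contr (u : J → R) (x : KoszulSpace k R V) : contr b u (contr b u x) = 0 := by
  induction x using koszul_induction b with
  | h1 => rw [contr_one, map_zero]
  | hadd x y hx hy => rw [map_add, map_add, hx, hy, add_zero]
  | hsmul r x hx => rw [map_smul, map_smul, hx, smul_zero]
  | hvec c x hx =>
    rw [contr_vec_mul, map_sub, contr_vec_mul, hx, map_smul, mul_zero, sub_zero, sub_self]

theorem contr_mem_gr {u : J → R} {p : ℤ} {S S' : Submodule k R} (h : ∀ i, ∀ s ∈ S, u i * s ∈ S')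
    {x : KoszulSpace k R V} (hx : x ∈ gr p S) : contr b u x ∈ gr (V := V) (p - 1) S' := by
  have : gr p S ≤ (gr (V := V) (p - 1) S').comap ((contr b u).restrictScalars k) :=
    gr_le.2 fun s hs y hy => by
      simp only [Submodule.mem_comap, LinearMap.restrictScalars_apply, contr_tmul]
      exact sum_mem fun i _ => tmul_mem_gr (h i s hs) (contractLeft_mem_extPiece _ hy)
  exact this hx

theorem vec_mul_mem_gr {c : J → R} {p : ℤ} {S S' : Submodule k R} (h : ∀ i, ∀ s ∈ S, c i * s ∈ S')
    {x : KoszulSpace k R V} (hx : x ∈ gr p S) : vec b c * x ∈ gr (V := V) (p + 1) S' := by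
  have : gr p S ≤ (gr (V := V) (p + 1) S').comap (LinearMap.mulLeft k (vec b c)) :=
    gr_le.2 fun s hs y hy => by
      simp only [Submodule.mem_comap, LinearMap.mulLeft_apply, vec, Finset.sum_mul,
        Algebra.TensorProduct.tmul_mul_tmul]
      exact sum_mem fun i _ => tmul_mem_gr (h i s hs) (ι_mul_mem_extPiece _ hy)
  exact this hx

theorem gr_zero_le {S : Submodule k R} {N : Submodule k (KoszulSpace k R V)}
    (h : ∀ r ∈ S, r • (1 : KoszulSpace k R V) ∈ N) : gr 0 S ≤ N := by
  refine gr_le.2 fun r hr x hx => ?_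
  rw [extPiece_zero, Submodule.mem_one] at hx
  obtain ⟨a, rfl⟩ := hx
  have : r ⊗ₜ[k] algebraMap k (ExteriorAlgebra k V) a = (a • r) • (1 : KoszulSpace k R V) := by
    rw [Algebra.algebraMap_eq_smul_one, TensorProduct.tmul_smul, Algebra.TensorProduct.one_def,
      TensorProduct.smul_tmul', TensorProduct.smul_tmul']
    simp
  rw [this]
  exact h _ (S.smul_mem a hr)

theorem gr_succ_le [DecidableEq J] {p : ℤ} (hp : 0 ≤ p) {S : Submodule k R}
    {N : Submodule k (KoszulSpace k R V)}
    (h : ∀ i, ∀ x ∈ gr p S, vec b (Pi.single i (1 : R)) * x ∈ N) : gr (p + 1) S ≤ N := by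
  refine gr_le.2 fun r hr x hx => ?_
  rw [extPiece_succ hp] at hx
  induction hx using Submodule.mul_induction_on' with
  | mem_mul_mem m hm y hy =>
    obtain ⟨v, rfl⟩ := hm
    have : r ⊗ₜ[k] (ExteriorAlgebra.ι k v * y) =
        ∑ i, b.repr v i • (vec b (Pi.single i (1 : R)) * (r ⊗ₜ[k] y)) := by
      conv_lhs => rw [← b.sum_repr v]
      simp [-Module.Basis.sum_repr, map_sum, Finset.sum_mul, TensorProduct.tmul_sum, vec_single]
    rw [this]
    exact sum_mem fun i _ => N.smul_mem _ (h i _ (tmul_mem_gr hr hy))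
  | add x _ y _ hx hy => rw [TensorProduct.tmul_add]; exact add_mem hx hy

theorem rTensor_contr {R' : Type*} [CommRing R'] [Algebra k R'] (ψ : R →ₗ[k] R') {u : J → R}
    {u' : J → R'} (h : ∀ i r, ψ (u i * r) = u' i * ψ r) (x : KoszulSpace k R V) :
    ψ.rTensor (ExteriorAlgebra k V) (contr b u x) =
      contr b u' (ψ.rTensor (ExteriorAlgebra k V) x) := by
  induction x using TensorProduct.induction_on with
  | zero => simp
  | add x y hx hy => simp only [map_add, hx, hy]
  | tmul r x => simp only [contr_tmul, map_sum, LinearMap.rTensor_tmul, h]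

end Koszul

section Descent

variable {k M L : Type*} [Field k] [AddCommGroup M] [Module k M]

/-- The sum of the images of `N` under the maps `e l`, `l ∈ s`. -/
def imageSum (e : L → M →ₗ[k] M) (s : Finset L) (N : Submodule k M) : Submodule k M :=
  ⨆ l ∈ s, N.map (e l)

theorem map_mem_imageSum {e : L → M →ₗ[k] M} {s : Finset L} {N : Submodule k M} {l : L}
    (hl : l ∈ s) {x : M} (hx : x ∈ N) : e l x ∈ imageSum e s N :=
  Submodule.mem_iSup_of_mem l (Submodule.mem_iSup_of_mem hl (Submodule.mem_map_of_mem hx))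

theorem imageSum_le {e : L → M →ₗ[k] M} {s : Finset L} {N P : Submodule k M} :
    imageSum e s N ≤ P ↔ ∀ l ∈ s, ∀ x ∈ N, e l x ∈ P := by
  simp only [imageSum, iSup_le_iff, Submodule.map_le_iff_le_comap]
  rfl

theorem imageSum_mono {e : L → M →ₗ[k] M} {s t : Finset L} (h : s ⊆ t) (N : Submodule k M) :
    imageSum e s N ≤ imageSum e t N :=
  imageSum_le.2 fun _ hl _ hx => map_mem_imageSum (h hl) hx

theorem mem_imageSum_insert [DecidableEq L] {e : L → M →ₗ[k] M} {s : Finset L}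
    {N : Submodule k M} {l : L} {x : M} (hx : x ∈ imageSum e (insert l s) N) :
    ∃ ξ ∈ N, ∃ η ∈ imageSum e s N, x = e l ξ + η := by
  rw [imageSum, Finset.iSup_insert, Submodule.mem_sup] at hx
  obtain ⟨_, ⟨ξ, hξ, rfl⟩, η, hη, rfl⟩ := hx
  exact ⟨ξ, hξ, η, hη, rfl⟩

/-- Exactness in degree `(p, a, m)` of the filtered complex `(Z, D)` modulo the images of
the operators `e l`, `l ∈ s`. -/
def ExactMod (D : M →ₗ[k] M) (e : L → M →ₗ[k] M) (Z : ℤ → ℤ → ℤ → Submodule k M) (δ n : ℤ)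
    (s : Finset L) (p a m : ℤ) : Prop :=
  ∀ z ∈ Z p a m, D z ∈ imageSum e s (Z (p - 2) (a + δ) (m - n)) →
    ∃ z' ∈ Z (p + 1) (a - δ) m, z - D z' ∈ imageSum e s (Z (p - 1) a (m - n))

variable {D : M →ₗ[k] M} {e A : L → M →ₗ[k] M} {Z : ℤ → ℤ → ℤ → Submodule k M} {δ n : ℤ}

theorem ExactMod.of_insert [DecidableEq L]
    (hDZ : ∀ p a m, ∀ z ∈ Z p a m, D z ∈ Z (p - 1) (a + δ) m)
    (heZ : ∀ l p a m, ∀ z ∈ Z p a m, e l z ∈ Z (p + 1) a (m + n))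
    (hAZ : ∀ l p a m, ∀ z ∈ Z p a m, A l z ∈ Z (p - 1) a (m - n))
    (hDD : ∀ z, D (D z) = 0) (hDe : ∀ l z, D (e l z) = -e l (D z))
    (hee : ∀ l l' z, e l (e l' z) = -e l' (e l z)) (hee' : ∀ l z, e l (e l z) = 0)
    (hAe : ∀ l z, A l (e l z) + e l (A l z) = z)
    (hAe' : ∀ l l' z, l ≠ l' → A l (e l' z) + e l' (A l z) = 0)
    {s : Finset L} {l : L} (hl : l ∉ s) {p a m : ℤ}
    (h₁ : ExactMod D e Z δ n (insert l s) p a m)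
    (h₂ : ExactMod D e Z δ n (insert l s) (p - 1) a (m - n)) :
    ExactMod D e Z δ n s p a m := by
  intro z hz hDz
  obtain ⟨z', hz', hzz'⟩ := h₁ z hz (imageSum_mono (Finset.subset_insert _ _) _ hDz)
  obtain ⟨ξ, hξ, η, hη, hzeq⟩ := mem_imageSum_insert hzz'
  have hDη : D η ∈ imageSum e s (Z (p - 2) (a + δ) (m - n)) := by
    have : imageSum e s (Z (p - 1) a (m - n)) ≤
        (imageSum e s (Z (p - 2) (a + δ) (m - n))).comap D := by
      refine imageSum_le.2 fun l' hl' x hx => ?_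
      rw [Submodule.mem_comap, hDe]
      refine neg_mem (map_mem_imageSum hl' ?_)
      have := hDZ _ _ _ x hx
      rwa [show p - 1 - 1 = p - 2 by ring] at this
    exact this hη
  have heDξ : e l (D ξ) ∈ imageSum e s (Z (p - 2) (a + δ) (m - n)) := by
    have h := congrArg D hzeq
    rw [map_sub, hDD, sub_zero, map_add, hDe] at h
    have := sub_mem hDη hDz
    rwa [h, sub_add_cancel_right, neg_neg] at this
  have hDξZ : D ξ ∈ Z (p - 1 - 1) (a + δ) (m - n) := hDZ _ _ _ _ hξ
  have hDξ : D ξ ∈ imageSum e (insert l s) (Z (p - 1 - 2) (a + δ) (m - n - n)) := by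
    rw [← hAe l (D ξ)]
    refine add_mem ?_ (map_mem_imageSum (Finset.mem_insert_self _ _) ?_)
    · have : imageSum e s (Z (p - 2) (a + δ) (m - n)) ≤
          (imageSum e (insert l s) (Z (p - 1 - 2) (a + δ) (m - n - n))).comap (A l) := by
        refine imageSum_le.2 fun l' hl' x hx => ?_
        have hne : l ≠ l' := by rintro rfl; exact hl hl'
        rw [Submodule.mem_comap, eq_neg_of_add_eq_zero_left (hAe' l l' x hne)]
        refine neg_mem (map_mem_imageSum (Finset.mem_insert_of_mem hl') ?_)
        have := hAZ l _ _ _ x hx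
        rwa [show p - 2 - 1 = p - 1 - 2 by ring] at this
      exact this heDξ
    · have := hAZ l _ _ _ _ hDξZ
      rwa [show p - 1 - 1 - 1 = p - 1 - 2 by ring] at this
  obtain ⟨ξ', hξ', hξξ'⟩ := h₂ ξ hξ hDξ
  refine ⟨z' - e l ξ', sub_mem hz' ?_, ?_⟩
  · have := heZ l _ _ _ _ hξ'
    rwa [show p - 1 + 1 + 1 = p + 1 by ring, sub_add_cancel] at this
  · have h : z - D (z' - e l ξ') = e l (ξ - D ξ') + η := by
      rw [map_sub, hDe, map_sub, ← sub_add, hzeq]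
      abel
    rw [h]
    refine add_mem ?_ hη
    have : imageSum e (insert l s) (Z (p - 1 - 1) a (m - n - n)) ≤
        (imageSum e s (Z (p - 1) a (m - n))).comap (e l) := by
      refine imageSum_le.2 fun l' hl' x hx => ?_
      rw [Submodule.mem_comap]
      rcases Finset.mem_insert.1 hl' with rfl | hl'
      · rw [hee']
        exact zero_mem _
      · rw [hee]
        refine neg_mem (map_mem_imageSum hl' ?_)
        have := heZ l _ _ _ x hx
        rwa [sub_add_cancel, sub_add_cancel] at this
    exact this hξξ'

theorem exactMod_empty_of_univ [DecidableEq L] [Fintype L]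
    (hDZ : ∀ p a m, ∀ z ∈ Z p a m, D z ∈ Z (p - 1) (a + δ) m)
    (heZ : ∀ l p a m, ∀ z ∈ Z p a m, e l z ∈ Z (p + 1) a (m + n))
    (hAZ : ∀ l p a m, ∀ z ∈ Z p a m, A l z ∈ Z (p - 1) a (m - n))
    (hDD : ∀ z, D (D z) = 0) (hDe : ∀ l z, D (e l z) = -e l (D z))
    (hee : ∀ l l' z, e l (e l' z) = -e l' (e l z)) (hee' : ∀ l z, e l (e l z) = 0)
    (hAe : ∀ l z, A l (e l z) + e l (A l z) = z)
    (hAe' : ∀ l l' z, l ≠ l' → A l (e l' z) + e l' (A l z) = 0) {a : ℤ} {P : ℤ → ℤ → Prop}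
    (hP : ∀ p m, P p m → P (p - 1) (m - n))
    (hleaf : ∀ p m, P p m → ExactMod D e Z δ n Finset.univ p a m) {p m : ℤ} (h : P p m) :
    ExactMod D e Z δ n ∅ p a m := by
  suffices H : ∀ t : Finset L, ∀ p m, P p m → ExactMod D e Z δ n tᶜ p a m by
    simpa using H Finset.univ p m h
  intro t
  induction t using Finset.induction_on with
  | empty => simpa using hleaf
  | insert l t hl ih =>
    intro p m h
    have hi : tᶜ = insert l (insert l t)ᶜ := by
      rw [Finset.compl_insert, Finset.insert_erase (by simpa using hl)]
    rw [hi] at ih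
    exact ExactMod.of_insert hDZ heZ hAZ hDD hDe hee hee' hAe hAe' (by simp) (ih p m h)
      (ih _ _ (hP p m h))

end Descent

section Rings

open LaurentPolynomial hiding C

variable {k : Type*} [Field k]

/-- The forms of degree `a ∈ ℤ` in `N` variables. -/
abbrev forms (k : Type*) [Field k] (N : ℕ) (a : ℤ) : Submodule k (MvPolynomial (Fin N) k) :=
  component k (fun _ : Fin N => (1 : ℤ)) a

theorem X_mem_forms {N : ℕ} (j : Fin N) : (X j : MvPolynomial (Fin N) k) ∈ forms k N 1 :=
  isWeightedHomogeneous_X k (fun _ : Fin N => (1 : ℤ)) j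

theorem one_mem_forms {N : ℕ} : (1 : MvPolynomial (Fin N) k) ∈ forms k N 0 :=
  isWeightedHomogeneous_one k _

theorem mul_mem_forms {N : ℕ} {a c : ℤ} {f g : MvPolynomial (Fin N) k} (hf : f ∈ forms k N a)
    (hg : g ∈ forms k N c) : f * g ∈ forms k N (a + c) :=
  IsWeightedHomogeneous.mul (w := fun _ : Fin N => (1 : ℤ)) hf hg

theorem weight_one_eq_degree {N : ℕ} (μ : Fin N →₀ ℕ) :
    Finsupp.weight (fun _ : Fin N => (1 : ℤ)) μ = (μ.degree : ℤ) := by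
  simp [Finsupp.weight_apply, Finsupp.degree_apply, Finsupp.sum]

theorem monomial_mem_forms {N : ℕ} (μ : Fin N →₀ ℕ) (r : k) :
    monomial μ r ∈ forms k N (μ.degree : ℤ) :=
  isWeightedHomogeneous_monomial _ _ _ (weight_one_eq_degree μ)

theorem forms_le {N : ℕ} {a : ℤ} {P : Submodule k (MvPolynomial (Fin N) k)}
    (h : ∀ μ : Fin N →₀ ℕ, (μ.degree : ℤ) = a → monomial μ 1 ∈ P) : forms k N a ≤ P := by
  intro f hf
  rw [f.as_sum]
  refine sum_mem fun μ hμ => ?_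
  have h1 : monomial μ (coeff μ f) = coeff μ f • (monomial μ 1 : MvPolynomial (Fin N) k) := by
    rw [smul_monomial, smul_eq_mul, mul_one]
  rw [h1]
  refine P.smul_mem _ (h μ ?_)
  rw [← weight_one_eq_degree]
  exact hf (mem_support_iff.1 hμ)

theorem forms_zero_le {N : ℕ} {P : Submodule k (MvPolynomial (Fin N) k)} (h : 1 ∈ P) :
    forms k N 0 ≤ P := by
  refine forms_le fun μ hμ => ?_
  have : μ = 0 := (Finsupp.degree_eq_zero_iff μ).1 (by exact_mod_cast hμ)
  rwa [this]

theorem forms_succ_le {N : ℕ} {a : ℤ} (ha : 0 ≤ a) {P : Submodule k (MvPolynomial (Fin N) k)}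
    (h : ∀ i, ∀ f ∈ forms k N a, X i * f ∈ P) : forms k N (a + 1) ≤ P := by
  refine forms_le fun μ hμ => ?_
  obtain ⟨i, hi⟩ : ∃ i, μ i ≠ 0 := by
    by_contra! hμ0
    have : μ = 0 := Finsupp.ext hμ0
    rw [this, map_zero] at hμ
    push_cast at hμ
    omega
  have hle : Finsupp.single i 1 ≤ μ := by
    rw [Finsupp.single_le_iff]
    omega
  have hdecomp : μ = Finsupp.single i 1 + (μ - Finsupp.single i 1) :=
    (add_tsub_cancel_of_le hle).symm
  have hm : (monomial μ 1 : MvPolynomial (Fin N) k) =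
      X i * monomial (μ - Finsupp.single i 1) 1 := by
    conv_lhs => rw [hdecomp]
    rw [X, monomial_mul, one_mul]
  rw [hm]
  refine h i _ ?_
  have h2 := congrArg Finsupp.degree hdecomp
  rw [map_add, Finsupp.degree_single] at h2
  have : a = ((μ - Finsupp.single i 1).degree : ℤ) := by omega
  rw [this]
  exact monomial_mem_forms _ _

/-- Laurent polynomials in one variable over the polynomial ring in `n` variables. -/
abbrev Laurent (k : Type*) [Field k] (n : ℕ) : Type _ := LaurentPolynomial (MvPolynomial (Fin n) k)

variable {n : ℕ}

/-- The Laurent polynomials whose exponents lie in `P` and whose coefficients are forms of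
degree `a`. -/
def laurentForms (k : Type*) [Field k] (n : ℕ) (a : ℤ) (P : Set ℤ) : Submodule k (Laurent k n) :=
  Submodule.span k {r | ∃ f ∈ forms k n a, ∃ j ∈ P, r = LaurentPolynomial.C f * T j}

theorem C_mul_T_mem {a : ℤ} {P : Set ℤ} {f : MvPolynomial (Fin n) k} {j : ℤ}
    (hf : f ∈ forms k n a) (hj : j ∈ P) : LaurentPolynomial.C f * T j ∈ laurentForms k n a P :=
  Submodule.subset_span ⟨f, hf, j, hj, rfl⟩

theorem laurentForms_le {a : ℤ} {P : Set ℤ} {N : Submodule k (Laurent k n)} :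
    laurentForms k n a P ≤ N ↔ ∀ f ∈ forms k n a, ∀ j ∈ P, LaurentPolynomial.C f * T j ∈ N := by
  rw [laurentForms, Submodule.span_le]
  constructor
  · exact fun h f hf j hj => h ⟨f, hf, j, hj, rfl⟩
  · rintro h _ ⟨f, hf, j, hj, rfl⟩
    exact h f hf j hj

theorem laurentForms_mono {a : ℤ} {P P' : Set ℤ} (h : P ⊆ P') :
    laurentForms k n a P ≤ laurentForms k n a P' :=
  laurentForms_le.2 fun _ hf _ hj => C_mul_T_mem hf (h hj)

theorem C_mem_laurentForms {a : ℤ} {f : MvPolynomial (Fin n) k} (hf : f ∈ forms k n a) :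
    LaurentPolynomial.C f ∈ laurentForms k n a {0} := by
  simpa using C_mul_T_mem hf (Set.mem_singleton (0 : ℤ))

theorem T_mem_laurentForms (j : ℤ) : (T j : Laurent k n) ∈ laurentForms k n 0 {j} := by
  simpa using C_mul_T_mem one_mem_forms (Set.mem_singleton j)

theorem mul_mem_laurentForms {a a' a'' : ℤ} {P P' P'' : Set ℤ} (ha : a + a' = a'')
    (hP : ∀ i ∈ P, ∀ j ∈ P', i + j ∈ P'') {r r' : Laurent k n} (hr : r ∈ laurentForms k n a P)
    (hr' : r' ∈ laurentForms k n a' P') : r * r' ∈ laurentForms k n a'' P'' := by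
  have h1 : laurentForms k n a P ≤ (laurentForms k n a'' P'').comap (LinearMap.mulRight k r') := by
    refine laurentForms_le.2 fun f hf i hi => ?_
    have h2 : laurentForms k n a' P' ≤
        (laurentForms k n a'' P'').comap (LinearMap.mulLeft k (LaurentPolynomial.C f * T i)) := by
      refine laurentForms_le.2 fun g hg j hj => ?_
      rw [Submodule.mem_comap, LinearMap.mulLeft_apply]
      have : (LaurentPolynomial.C f * T i * (LaurentPolynomial.C g * T j) : Laurent k n) =
          LaurentPolynomial.C (f * g) * T (i + j) := by
        rw [map_mul, T_add]
        ring
      rw [this]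
      exact C_mul_T_mem (ha ▸ mul_mem_forms hf hg) (hP i hi j hj)
    exact h2 hr'
  exact h1 hr

/-- The coefficient of `t ^ j`. -/
def tCoeff (k : Type*) [Field k] (n : ℕ) (j : ℤ) : Laurent k n →ₗ[k] MvPolynomial (Fin n) k :=
  Finsupp.lapply j ∘ₗ (AddMonoidAlgebra.coeffLinearEquiv k).toLinearMap

/-- Multiplication by `t ^ j`, from polynomials to Laurent polynomials. -/
def tMonomial (k : Type*) [Field k] (n : ℕ) (j : ℤ) : MvPolynomial (Fin n) k →ₗ[k] Laurent k n :=
  (AddMonoidAlgebra.coeffLinearEquiv k).symm.toLinearMap ∘ₗ Finsupp.lsingle j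

/-- The part of a Laurent polynomial with exponents in `P`. -/
def tProj (k : Type*) [Field k] (n : ℕ) (P : Set ℤ) : Laurent k n →ₗ[k] Laurent k n :=
  open Classical in
  Finsupp.lsum k (fun j => if j ∈ P then tMonomial k n j else 0) ∘ₗ
    (AddMonoidAlgebra.coeffLinearEquiv k).toLinearMap

theorem tMonomial_apply (j : ℤ) (f : MvPolynomial (Fin n) k) :
    tMonomial k n j f = LaurentPolynomial.C f * T j := by
  rw [← single_eq_C_mul_T]
  rfl

theorem coeffLinearEquiv_C_mul_T (j : ℤ) (f : MvPolynomial (Fin n) k) :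
    AddMonoidAlgebra.coeffLinearEquiv k (LaurentPolynomial.C f * T j) = Finsupp.single j f := by
  rw [← single_eq_C_mul_T]
  rfl

theorem tCoeff_C_mul_T (j i : ℤ) (f : MvPolynomial (Fin n) k) :
    tCoeff k n j (LaurentPolynomial.C f * T i) = if i = j then f else 0 := by
  rw [tCoeff, LinearMap.comp_apply, LinearEquiv.coe_coe, coeffLinearEquiv_C_mul_T,
    Finsupp.lapply_apply, Finsupp.single_apply]

open Classical in
theorem tProj_C_mul_T (P : Set ℤ) (i : ℤ) (f : MvPolynomial (Fin n) k) :
    tProj k n P (LaurentPolynomial.C f * T i) =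
      if i ∈ P then LaurentPolynomial.C f * T i else 0 := by
  rw [tProj, LinearMap.comp_apply, LinearEquiv.coe_coe, coeffLinearEquiv_C_mul_T,
    Finsupp.lsum_single]
  split_ifs
  · exact tMonomial_apply i f
  · rfl

theorem laurent_induction {P : Laurent k n → Prop} (hadd : ∀ x y, P x → P y → P (x + y))
    (h : ∀ f j, P (LaurentPolynomial.C f * T j)) (x : Laurent k n) : P x :=
  LaurentPolynomial.induction_on' x (fun x y hx hy => hadd x y hx hy) fun j f => h f j

theorem tProj_eq_self {a : ℤ} {P : Set ℤ} {r : Laurent k n} (hr : r ∈ laurentForms k n a P) :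
    tProj k n P r = r := by
  have : laurentForms k n a P ≤ LinearMap.eqLocus (tProj k n P) LinearMap.id :=
    laurentForms_le.2 fun f _ j hj => by
      rw [LinearMap.mem_eqLocus, tProj_C_mul_T, if_pos hj, LinearMap.id_apply]
  exact this hr

theorem tProj_mem {a : ℤ} (P P' : Set ℤ) {r : Laurent k n} (hr : r ∈ laurentForms k n a P') :
    tProj k n P r ∈ laurentForms k n a (P ∩ P') := by
  have : laurentForms k n a P' ≤ (laurentForms k n a (P ∩ P')).comap (tProj k n P) :=
    laurentForms_le.2 fun f hf j hj => by
      rw [Submodule.mem_comap, tProj_C_mul_T]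
      split_ifs with h
      · exact C_mul_T_mem hf ⟨h, hj⟩
      · exact zero_mem _
  exact this hr

theorem sub_tProj_mem {a : ℤ} (P P' : Set ℤ) {r : Laurent k n} (hr : r ∈ laurentForms k n a P') :
    r - tProj k n P r ∈ laurentForms k n a (P' \ P) := by
  have : laurentForms k n a P' ≤
      (laurentForms k n a (P' \ P)).comap (LinearMap.id - tProj k n P) :=
    laurentForms_le.2 fun f hf j hj => by
      rw [Submodule.mem_comap, LinearMap.sub_apply, LinearMap.id_apply, tProj_C_mul_T]
      split_ifs with h
      · rw [sub_self]
        exact zero_mem _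
      · rw [sub_zero]
        exact C_mul_T_mem hf ⟨hj, h⟩
  exact this hr

theorem tProj_C_mul (P : Set ℤ) (f : MvPolynomial (Fin n) k) (r : Laurent k n) :
    tProj k n P (LaurentPolynomial.C f * r) = LaurentPolynomial.C f * tProj k n P r := by
  induction r using laurent_induction with
  | hadd x y hx hy => simp only [mul_add, map_add, hx, hy]
  | h g j =>
    rw [← mul_assoc, ← map_mul, tProj_C_mul_T, tProj_C_mul_T]
    split_ifs
    · rw [map_mul, mul_assoc]
    · rw [mul_zero]

theorem tCoeff_mem {a : ℤ} {P : Set ℤ} (j : ℤ) {r : Laurent k n} (hr : r ∈ laurentForms k n a P) :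
    tCoeff k n j r ∈ forms k n a := by
  have : laurentForms k n a P ≤ (forms k n a).comap (tCoeff k n j) :=
    laurentForms_le.2 fun f hf i _ => by
      rw [Submodule.mem_comap, tCoeff_C_mul_T]
      split_ifs
      · exact hf
      · exact zero_mem _
  exact this hr

theorem tCoeff_eq_zero {a : ℤ} {P : Set ℤ} {j : ℤ} (hj : j ∉ P) {r : Laurent k n}
    (hr : r ∈ laurentForms k n a P) : tCoeff k n j r = 0 := by
  have : laurentForms k n a P ≤ LinearMap.ker (tCoeff k n j) :=
    laurentForms_le.2 fun f hf i hi => by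
      rw [LinearMap.mem_ker, tCoeff_C_mul_T, if_neg]
      rintro rfl
      exact hj hi
  exact this hr

theorem tCoeff_C_mul (j : ℤ) (f : MvPolynomial (Fin n) k) (r : Laurent k n) :
    tCoeff k n j (LaurentPolynomial.C f * r) = f * tCoeff k n j r := by
  induction r using laurent_induction with
  | hadd x y hx hy => simp only [mul_add, map_add, hx, hy]
  | h g i =>
    rw [← mul_assoc, ← map_mul, tCoeff_C_mul_T, tCoeff_C_mul_T]
    split_ifs
    · rfl
    · rw [mul_zero]

theorem tMonomial_mul (j : ℤ) (f g : MvPolynomial (Fin n) k) :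
    tMonomial k n j (f * g) = LaurentPolynomial.C f * tMonomial k n j g := by
  rw [tMonomial_apply, tMonomial_apply, map_mul, mul_assoc]

variable {V J : Type*} [AddCommGroup V] [Module k V]

theorem exists_eq_sum_tMonomial_tCoeff (x : KoszulSpace k (Laurent k n) V) :
    ∃ s : Finset ℤ, ∀ s', s ⊆ s' → ∑ j ∈ s', (tMonomial k n j).rTensor (ExteriorAlgebra k V)
      ((tCoeff k n j).rTensor (ExteriorAlgebra k V) x) = x := by
  classical
  induction x using TensorProduct.induction_on with
  | zero => exact ⟨∅, fun s' _ => by simp⟩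
  | add x y hx hy =>
    obtain ⟨s, hs⟩ := hx
    obtain ⟨s', hs'⟩ := hy
    refine ⟨s ∪ s', fun s'' h => ?_⟩
    simp only [map_add, Finset.sum_add_distrib]
    rw [hs _ (Finset.union_subset_left h), hs' _ (Finset.union_subset_right h)]
  | tmul r x =>
    induction r using laurent_induction with
    | hadd r r' hr hr' =>
      obtain ⟨s, hs⟩ := hr
      obtain ⟨s', hs'⟩ := hr'
      refine ⟨s ∪ s', fun s'' h => ?_⟩
      simp only [TensorProduct.add_tmul, map_add, Finset.sum_add_distrib]
      rw [hs _ (Finset.union_subset_left h), hs' _ (Finset.union_subset_right h)]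
    | h f j =>
      refine ⟨{j}, fun s' hs' => ?_⟩
      rw [Finset.sum_eq_single j]
      · simp only [LinearMap.rTensor_tmul, tCoeff_C_mul_T, if_true, tMonomial_apply]
      · intro i _ hi
        simp only [LinearMap.rTensor_tmul, tCoeff_C_mul_T, if_neg hi.symm, map_zero,
          TensorProduct.zero_tmul]
      · intro hj
        exact absurd (hs' (Finset.mem_singleton_self j)) hj

variable [Fintype J] (b : Module.Basis J k V)

theorem exists_contr_eq_laurent {v : J → MvPolynomial (Fin n) k} {p a a' : ℤ}
    (H : ∀ α ∈ gr (V := V) p (forms k n a), contr b v α = 0 →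
      ∃ β ∈ gr (V := V) (p + 1) (forms k n a'), contr b v β = α) {P : Set ℤ}
    {α : KoszulSpace k (Laurent k n) V} (hα : α ∈ gr p (laurentForms k n a P))
    (hdα : contr b (fun i => LaurentPolynomial.C (v i)) α = 0) :
    ∃ β ∈ gr (V := V) (p + 1) (laurentForms k n a' P),
      contr b (fun i => LaurentPolynomial.C (v i)) β = α := by
  have h1 : ∀ j, ∃ β ∈ gr (V := V) (p + 1) (forms k n a'),
      contr b v β = (tCoeff k n j).rTensor (ExteriorAlgebra k V) α := by
    refine fun j => H _ (rTensor_mem_gr _ (fun _ hs => tCoeff_mem j hs) hα) ?_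
    rw [← rTensor_contr b (tCoeff k n j) (u := fun i => LaurentPolynomial.C (v i))
      fun i r => tCoeff_C_mul j _ r,
      hdα, map_zero]
  choose β hβ hdβ using h1
  obtain ⟨s, hs⟩ := exists_eq_sum_tMonomial_tCoeff α
  classical
  refine ⟨∑ j ∈ s with j ∈ P, (tMonomial k n j).rTensor (ExteriorAlgebra k V) (β j),
    sum_mem fun j hj => rTensor_mem_gr _ (fun f hf => ?_) (hβ j), ?_⟩
  · rw [tMonomial_apply]
    exact C_mul_T_mem hf (Finset.mem_filter.1 hj).2
  · conv_rhs => rw [← hs s subset_rfl]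
    rw [map_sum, Finset.sum_filter]
    refine Finset.sum_congr rfl fun j _ => ?_
    split_ifs with h
    · rw [← rTensor_contr b (tMonomial k n j) (u := v) fun i r => tMonomial_mul j _ r, hdβ]
    · have : (tCoeff k n j).rTensor (ExteriorAlgebra k V) α = 0 := by
        have := rTensor_eq_of_mem_gr (ψ := tCoeff k n j) (ψ' := 0)
          (fun s hs => tCoeff_eq_zero h hs) hα
        rw [this, LinearMap.rTensor_zero, LinearMap.zero_apply]
      rw [this, map_zero]

end Rings

section ExtHom

variable {k V V' V'' J J' J'' R : Type*} [Field k] [AddCommGroup V] [Module k V]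
  [AddCommGroup V'] [Module k V'] [AddCommGroup V''] [Module k V''] [CommRing R] [Algebra k R]
  [Fintype J] [Fintype J'] [Fintype J'']
  (b : Module.Basis J k V) (b' : Module.Basis J' k V') (b'' : Module.Basis J'' k V'')

/-- `vec b` as a linear map. -/
def vecₗ : (J → R) →ₗ[R] KoszulSpace k R V where
  toFun := vec b
  map_add' := vec_add b
  map_smul' := vec_smul b

/-- The homomorphism of exterior algebras over `R` sending the basis vector `b i` to the vector
with coordinates `c i`. -/
def extHom (c : J → J' → R) : KoszulSpace k R V →ₐ[R] KoszulSpace k R V' :=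
  Algebra.TensorProduct.lift (Algebra.ofId R _)
    (ExteriorAlgebra.lift k ⟨b.constr k fun i => vec b' (c i), fun m => by
      have : b.constr k (fun i => vec b' (c i)) m =
          vec b' (∑ i, b.repr m i • c i) := by
        rw [Module.Basis.constr_apply_fintype]
        change _ = vecₗ b' _
        simp only [map_sum, LinearMap.map_smul_of_tower, Module.Basis.equivFun_apply]
        rfl
      rw [this, vec_mul_self]⟩)
    fun r x => by
      rw [Algebra.ofId_apply]
      exact Algebra.commute_algebraMap_left _ _

theorem extHom_vec (c : J → J' → R) (x : J → R) :
    extHom b b' c (vec b x) = vec b' (fun j => ∑ i, x i * c i j) := by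
  have h : vec b' (fun j => ∑ i, x i * c i j) = ∑ i, x i • vec b' (c i) := by
    have : (fun j => ∑ i, x i * c i j) = ∑ i, x i • c i := by
      ext j
      simp
    rw [this]
    change vecₗ b' _ = _
    rw [map_sum]
    simp only [map_smul]
    rfl
  rw [h, vec, map_sum]
  refine Finset.sum_congr rfl fun i _ => ?_
  rw [extHom, Algebra.TensorProduct.lift_tmul, ExteriorAlgebra.lift_ι_apply,
    Module.Basis.constr_basis, Algebra.ofId_apply, Algebra.smul_def]

theorem algHom_ext_vec {B : Type*} [Ring B] [Algebra R B] {f g : KoszulSpace k R V →ₐ[R] B}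
    (h : ∀ x, f (vec b x) = g (vec b x)) : f = g := by
  ext x
  induction x using koszul_induction b with
  | h1 => rw [map_one, map_one]
  | hadd x y hx hy => rw [map_add, map_add, hx, hy]
  | hsmul r x hx => rw [map_smul, map_smul, hx]
  | hvec c x hx => rw [map_mul, map_mul, hx, h]

theorem extHom_extHom (c : J → J' → R) (c' : J' → J'' → R) (x : KoszulSpace k R V) :
    extHom b' b'' c' (extHom b b' c x) = extHom b b'' (fun i l => ∑ j, c i j * c' j l) x := by
  have : (extHom b' b'' c').comp (extHom b b' c) =
      extHom b b'' (fun i l => ∑ j, c i j * c' j l) := by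
    refine algHom_ext_vec b fun x => ?_
    rw [AlgHom.comp_apply, extHom_vec, extHom_vec, extHom_vec]
    congr 1
    ext l
    simp only [Finset.sum_mul, Finset.mul_sum]
    rw [Finset.sum_comm]
    simp only [mul_assoc]
  rw [← this, AlgHom.comp_apply]

theorem extHom_one [DecidableEq J] (x : KoszulSpace k R V) :
    extHom b b (fun i => Pi.single i (1 : R)) x = x := by
  have : extHom b b (fun i => Pi.single i (1 : R)) = AlgHom.id R _ := by
    refine algHom_ext_vec b fun x => ?_
    rw [extHom_vec, AlgHom.id_apply]
    congr 1
    ext j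
    simp [Pi.single_apply]
  rw [this, AlgHom.id_apply]

theorem contr_extHom (c : J → J' → R) (u : J → R) (u' : J' → R) (h : ∀ i, u i = ∑ j, c i j * u' j)
    (x : KoszulSpace k R V) : contr b' u' (extHom b b' c x) = extHom b b' c (contr b u x) := by
  induction x using koszul_induction b with
  | h1 => rw [map_one, contr_one, contr_one, map_zero]
  | hadd x y hx hy => simp only [map_add, hx, hy]
  | hsmul r x hx => simp only [map_smul, hx]
  | hvec e x hx =>
    rw [map_mul, extHom_vec, contr_vec_mul, contr_vec_mul, map_sub, map_mul, map_smul,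
      extHom_vec, hx]
    congr 2
    simp only [h, Finset.mul_sum, Finset.sum_mul]
    rw [Finset.sum_comm]
    exact Finset.sum_congr rfl fun i _ => Finset.sum_congr rfl fun j _ => by ring

theorem extHom_mem_gr {c : J → J' → R} {S : Submodule k R} (h : ∀ i j, ∀ s ∈ S, c i j * s ∈ S)
    {p : ℤ} {x : KoszulSpace k R V} (hx : x ∈ gr p S) :
    extHom b b' c x ∈ gr (V := V') p S := by
  classical
  rcases lt_or_ge p 0 with hp | hp
  · rw [gr_of_neg hp, Submodule.mem_bot] at hx
    rw [hx, map_zero]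
    exact zero_mem _
  lift p to ℕ using hp
  suffices H : gr p S ≤ (gr (V := V') p S).comap ((extHom b b' c).toLinearMap.restrictScalars k)
    from H hx
  clear hx x
  induction p with
  | zero =>
    refine gr_zero_le fun r hr => ?_
    simp only [Submodule.mem_comap, LinearMap.restrictScalars_apply, AlgHom.toLinearMap_apply,
      map_smul, map_one]
    rw [Algebra.TensorProduct.one_def, TensorProduct.smul_tmul', smul_eq_mul, mul_one]
    refine tmul_mem_gr hr ?_
    rw [Nat.cast_zero, extPiece_zero]
    exact Submodule.mem_one.2 ⟨1, map_one _⟩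
  | succ p ih =>
    rw [Nat.cast_succ]
    refine gr_succ_le b (by positivity) fun i x hx => ?_
    simp only [Submodule.mem_comap, LinearMap.restrictScalars_apply, AlgHom.toLinearMap_apply,
      map_mul, extHom_vec]
    refine vec_mul_mem_gr b' (fun j s hs => ?_) (ih hx)
    simpa [Pi.single_apply] using h i j s hs

theorem extHom_smul_of_mem_gr (c : J → J' → R) (t : R) {S : Submodule k R} {p : ℕ}
    {x : KoszulSpace k R V} (hx : x ∈ gr (p : ℤ) S) :
    extHom b b' (fun i j => t * c i j) x = t ^ p • extHom b b' c x := by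
  classical
  suffices H : gr p S ≤ LinearMap.eqLocus
      ((extHom b b' (fun i j => t * c i j)).toLinearMap.restrictScalars k)
      ((t ^ p • (extHom b b' c).toLinearMap).restrictScalars k) from H hx
  clear hx x
  induction p with
  | zero =>
    refine gr_zero_le fun r hr => ?_
    simp [LinearMap.mem_eqLocus]
  | succ p ih =>
    rw [Nat.cast_succ]
    refine gr_succ_le b (by positivity) fun i x hx => ?_
    have h1 := ih hx
    simp only [LinearMap.mem_eqLocus, LinearMap.restrictScalars_apply, AlgHom.toLinearMap_apply,
      LinearMap.smul_apply, map_mul] at h1 ⊢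
    rw [h1, extHom_vec, extHom_vec]
    have h2 : (fun j => ∑ i', (Pi.single i (1 : R) : J → R) i' * (t * c i' j)) =
        t • fun j => ∑ i', (Pi.single i (1 : R) : J → R) i' * c i' j := by
      ext j
      simp [Pi.single_apply]
    rw [h2, vec_smul, smul_mul_smul_comm, pow_succ']

variable {L : Type*} [Fintype L]

theorem exists_sub_extHom_eq [DecidableEq J] {c : J → J' → R} {s : J' → J → R} {q w : L → J → R}
    (hq : ∀ i i', (∑ j, c i j * s j i') + ∑ l, q l i * w l i' = (Pi.single i (1 : R) : J → R) i')
    {S : Submodule k R} (hc : ∀ i j, ∀ r ∈ S, c i j * r ∈ S) (hs : ∀ j i, ∀ r ∈ S, s j i * r ∈ S)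
    (hqS : ∀ l i, ∀ r ∈ S, q l i * r ∈ S) {p : ℤ} {x : KoszulSpace k R V} (hx : x ∈ gr p S) :
    ∃ ξ : L → KoszulSpace k R V, (∀ l, ξ l ∈ gr (p - 1) S) ∧
      x - extHom b' b s (extHom b b' c x) = ∑ l, vec b (w l) * ξ l := by
  rcases lt_or_ge p 0 with hp | hp
  · rw [gr_of_neg hp, Submodule.mem_bot] at hx
    exact ⟨0, fun l => zero_mem _, by simp [hx]⟩
  lift p to ℕ using hp
  let N (p : ℤ) : Submodule k (KoszulSpace k R V) :=
    { carrier := {x | ∃ ξ : L → KoszulSpace k R V, (∀ l, ξ l ∈ gr (p - 1) S) ∧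
        x - extHom b' b s (extHom b b' c x) = ∑ l, vec b (w l) * ξ l}
      zero_mem' := ⟨0, fun l => zero_mem _, by simp⟩
      add_mem' := by
        rintro x y ⟨ξ, hξ, hx⟩ ⟨η, hη, hy⟩
        refine ⟨ξ + η, fun l => add_mem (hξ l) (hη l), ?_⟩
        simp only [map_add, Pi.add_apply, mul_add, Finset.sum_add_distrib, ← hx, ← hy]
        abel
      smul_mem' := by
        rintro a x ⟨ξ, hξ, hx⟩
        refine ⟨a • ξ, fun l => Submodule.smul_mem _ _ (hξ l), ?_⟩
        have h1 : ∀ y : KoszulSpace k R V, a • y = algebraMap k R a • y := fun y => by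
          rw [algebraMap_smul]
        have h2 : extHom b' b s (extHom b b' c (a • x)) =
            a • extHom b' b s (extHom b b' c x) := by
          rw [h1 x, map_smul, map_smul, ← h1]
        simp only [h2, Pi.smul_apply, mul_smul_comm]
        rw [← smul_sub, hx, Finset.smul_sum] }
  suffices H : gr p S ≤ N p from H hx
  clear hx x
  induction p with
  | zero =>
    refine gr_zero_le fun r hr => ⟨0, fun l => zero_mem _, ?_⟩
    simp
  | succ p ih =>
    rw [Nat.cast_succ]
    refine gr_succ_le b (by positivity) fun i x hx => ?_
    obtain ⟨ξ, hξ, hxξ⟩ := ih hx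
    set g := vec b (Pi.single i (1 : R)) with hg
    set g' := vec b (fun i' => ∑ j, c i j * s j i') with hg'
    have h1 : extHom b' b s (extHom b b' c g) = g' := by
      rw [extHom_extHom, hg, extHom_vec, hg']
      congr 1
      ext i'
      simp [Pi.single_apply]
    have h2 : g = g' + ∑ l, q l i • vec b (w l) := by
      have : (Pi.single i (1 : R) : J → R) =
          (fun i' => ∑ j, c i j * s j i') + ∑ l, q l i • w l := by
        ext i'
        simp [← hq]
      rw [hg, this, vec_add, hg']
      congr 1
      change vecₗ b _ = _
      rw [map_sum]
      simp only [map_smul]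
      rfl
    refine ⟨fun l => q l i • x - g' * ξ l, fun l => sub_mem ?_ ?_, ?_⟩
    · rw [add_sub_cancel_right]
      exact smul_mem_gr (hqS l i) hx
    · have := vec_mul_mem_gr b (c := fun i' => ∑ j, c i j * s j i') (S' := S)
        (fun i' r hr => ?_) (hξ l)
      · rwa [sub_add_cancel, ← hg', ← add_sub_cancel_right (p : ℤ) 1] at this
      · rw [Finset.sum_mul]
        refine sum_mem fun j _ => ?_
        rw [mul_assoc]
        exact hc _ _ _ (hs _ _ _ hr)
    · rw [map_mul, map_mul, h1]
      have h3 : g * x - g' * extHom b' b s (extHom b b' c x) =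
          (∑ l, q l i • vec b (w l)) * x + g' * (x - extHom b' b s (extHom b b' c x)) := by
        rw [h2]
        noncomm_ring
      rw [h3, hxξ, Finset.sum_mul, Finset.mul_sum, ← Finset.sum_add_distrib]
      refine Finset.sum_congr rfl fun l _ => ?_
      rw [mul_sub, ← mul_assoc g', ← mul_assoc _ g', hg', vec_mul_vec b _ (w l), neg_mul,
        sub_eq_add_neg, smul_mul_assoc, mul_smul_comm]

end ExtHom

section Cone

variable {k V J R L : Type*} [Field k] [AddCommGroup V] [Module k V] [CommRing R] [Algebra k R]
  [Fintype J] (b : Module.Basis J k V)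

/-- The differential of the Čech cone of the Koszul complex for a covering by two charts. -/
def coneD (v : J → R) :
    (KoszulSpace k R V × KoszulSpace k R V × KoszulSpace k R V) →ₗ[k]
      (KoszulSpace k R V × KoszulSpace k R V × KoszulSpace k R V) where
  toFun z := (contr b v z.1, contr b v z.2.1, z.1 - z.2.1 - contr b v z.2.2)
  map_add' z z' := by
    simp only [Prod.fst_add, Prod.snd_add, map_add, Prod.mk_add_mk, Prod.mk.injEq, true_and]
    abel
  map_smul' r z := by
    simp only [Prod.smul_fst, Prod.smul_snd, LinearMap.map_smul_of_tower, RingHom.id_apply,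
      Prod.smul_mk, smul_sub]

/-- Multiplication by a vector on the cone. -/
def coneE (c : J → R) :
    (KoszulSpace k R V × KoszulSpace k R V × KoszulSpace k R V) →ₗ[k]
      (KoszulSpace k R V × KoszulSpace k R V × KoszulSpace k R V) where
  toFun z := (vec b c * z.1, vec b c * z.2.1, -(vec b c * z.2.2))
  map_add' z z' := by
    simp only [Prod.fst_add, Prod.snd_add, mul_add, Prod.mk_add_mk, Prod.mk.injEq, true_and]
    abel
  map_smul' r z := by
    simp only [Prod.smul_fst, Prod.smul_snd, mul_smul_comm, RingHom.id_apply,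
      Prod.smul_mk, smul_neg]

/-- Contraction on the cone, by possibly different functionals on the two charts. -/
def coneA (u₀ u₁ : J → R) :
    (KoszulSpace k R V × KoszulSpace k R V × KoszulSpace k R V) →ₗ[k]
      (KoszulSpace k R V × KoszulSpace k R V × KoszulSpace k R V) where
  toFun z := (contr b u₀ z.1, contr b u₁ z.2.1, -contr b u₀ z.2.2)
  map_add' z z' := by
    simp only [Prod.fst_add, Prod.snd_add, map_add, Prod.mk_add_mk, Prod.mk.injEq, true_and]
    abel
  map_smul' r z := by
    simp only [Prod.smul_fst, Prod.smul_snd, LinearMap.map_smul_of_tower, RingHom.id_apply,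
      Prod.smul_mk, smul_neg]

theorem coneD_apply (v : J → R) (z : KoszulSpace k R V × KoszulSpace k R V × KoszulSpace k R V) :
    coneD b v z = (contr b v z.1, contr b v z.2.1, z.1 - z.2.1 - contr b v z.2.2) := rfl

theorem coneE_apply (c : J → R) (z : KoszulSpace k R V × KoszulSpace k R V × KoszulSpace k R V) :
    coneE b c z = (vec b c * z.1, vec b c * z.2.1, -(vec b c * z.2.2)) := rfl

theorem coneA_apply (u₀ u₁ : J → R)
    (z : KoszulSpace k R V × KoszulSpace k R V × KoszulSpace k R V) :
    coneA b u₀ u₁ z = (contr b u₀ z.1, contr b u₁ z.2.1, -contr b u₀ z.2.2) := rfl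

theorem coneD_coneD (v : J → R)
    (z : KoszulSpace k R V × KoszulSpace k R V × KoszulSpace k R V) :
    coneD b v (coneD b v z) = 0 := by
  simp only [coneD_apply, contr_contr, map_sub, sub_zero, sub_self, Prod.mk_zero_zero]

theorem coneD_coneE {v c : J → R} (h : ∑ i, v i * c i = 0)
    (z : KoszulSpace k R V × KoszulSpace k R V × KoszulSpace k R V) :
    coneD b v (coneE b c z) = -coneE b c (coneD b v z) := by
  simp only [coneD_apply, coneE_apply, contr_vec_mul, h, zero_smul, zero_sub, map_neg, mul_sub,
    Prod.neg_mk, Prod.mk.injEq, true_and]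
  abel

theorem coneE_coneE (c c' : J → R)
    (z : KoszulSpace k R V × KoszulSpace k R V × KoszulSpace k R V) :
    coneE b c (coneE b c' z) = -coneE b c' (coneE b c z) := by
  simp only [coneE_apply, mul_neg, neg_neg, ← mul_assoc, vec_mul_vec b c c', neg_mul, Prod.neg_mk]

theorem coneE_coneE_self (c : J → R)
    (z : KoszulSpace k R V × KoszulSpace k R V × KoszulSpace k R V) :
    coneE b c (coneE b c z) = 0 := by
  simp only [coneE_apply, mul_neg, neg_neg, ← mul_assoc, vec_mul_self, zero_mul, Prod.mk_zero_zero]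

theorem coneA_coneE_add {u₀ u₁ c : J → R} {r : R} (h₀ : ∑ i, u₀ i * c i = r)
    (h₁ : ∑ i, u₁ i * c i = r)
    (z : KoszulSpace k R V × KoszulSpace k R V × KoszulSpace k R V) :
    coneA b u₀ u₁ (coneE b c z) + coneE b c (coneA b u₀ u₁ z) = r • z := by
  obtain ⟨x, y, z⟩ := z
  simp only [coneA_apply, coneE_apply, contr_vec_mul, h₀, h₁, map_neg, mul_neg, neg_neg,
    Prod.mk_add_mk, sub_add_cancel, Prod.smul_mk]

end Cone

section LaurentCone

variable {k V V' J J' L : Type*} [Field k] [AddCommGroup V] [Module k V]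
  [AddCommGroup V'] [Module k V'] [Fintype J] [Fintype J'] [Fintype L] {n : ℕ}
  (b : Module.Basis J k V) (b' : Module.Basis J' k V')

/-- The filtration of the cone by exterior degree, degree of the coefficients, and pole order. -/
def coneZ (k V : Type*) [Field k] [AddCommGroup V] [Module k V] (n : ℕ) (δ p a m : ℤ) :
    Submodule k (KoszulSpace k (Laurent k n) V × KoszulSpace k (Laurent k n) V ×
      KoszulSpace k (Laurent k n) V) :=
  (gr p (laurentForms k n a (Set.Ici 0))).prod
    ((gr p (laurentForms k n a (Set.Iic (a + m)))).prod
      (gr (p + 1) (laurentForms k n (a - δ) Set.univ)))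

variable {δ : ℤ}

theorem mem_coneZ {p a m : ℤ} {z : KoszulSpace k (Laurent k n) V ×
    KoszulSpace k (Laurent k n) V × KoszulSpace k (Laurent k n) V} :
    z ∈ coneZ k V n δ p a m ↔ z.1 ∈ gr p (laurentForms k n a (Set.Ici 0)) ∧
      z.2.1 ∈ gr p (laurentForms k n a (Set.Iic (a + m))) ∧
      z.2.2 ∈ gr (p + 1) (laurentForms k n (a - δ) Set.univ) := Iff.rfl

theorem contr_mem_gr_laurent {u : J → Laurent k n} {a₀ a a' p : ℤ} {P₀ P P' : Set ℤ}
    (hu : ∀ i, u i ∈ laurentForms k n a₀ P₀) (ha : a₀ + a = a')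
    (hP : ∀ i ∈ P₀, ∀ j ∈ P, i + j ∈ P') {x : KoszulSpace k (Laurent k n) V}
    (hx : x ∈ gr p (laurentForms k n a P)) :
    contr b u x ∈ gr (V := V) (p - 1) (laurentForms k n a' P') :=
  contr_mem_gr b (fun i _ hs => mul_mem_laurentForms ha hP (hu i) hs) hx

theorem vec_mul_mem_gr_laurent {c : J → Laurent k n} {a₀ a a' p : ℤ} {P₀ P P' : Set ℤ}
    (hc : ∀ i, c i ∈ laurentForms k n a₀ P₀) (ha : a₀ + a = a')
    (hP : ∀ i ∈ P₀, ∀ j ∈ P, i + j ∈ P') {x : KoszulSpace k (Laurent k n) V}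
    (hx : x ∈ gr p (laurentForms k n a P)) :
    vec b c * x ∈ gr (V := V) (p + 1) (laurentForms k n a' P') :=
  vec_mul_mem_gr b (fun i _ hs => mul_mem_laurentForms ha hP (hc i) hs) hx

theorem coneD_mem {v : J → Laurent k n} (hv : ∀ i, v i ∈ laurentForms k n δ (Set.Icc 0 δ))
    {p a m : ℤ} {z : KoszulSpace k (Laurent k n) V × KoszulSpace k (Laurent k n) V ×
      KoszulSpace k (Laurent k n) V} (hz : z ∈ coneZ k V n δ p a m) :
    coneD b v z ∈ coneZ k V n δ (p - 1) (a + δ) m := by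
  obtain ⟨h1, h2, h3⟩ := hz
  refine mem_coneZ.2 ⟨?_, ?_, ?_⟩
  · refine contr_mem_gr_laurent b hv (by ring) (fun i hi j hj => ?_) h1
    simp only [Set.mem_Icc, Set.mem_Ici] at *
    omega
  · refine contr_mem_gr_laurent b hv (by ring) (fun i hi j hj => ?_) h2
    simp only [Set.mem_Icc, Set.mem_Iic] at *
    omega
  · rw [sub_add_cancel, add_sub_cancel_right]
    refine sub_mem (sub_mem (gr_mono (laurentForms_mono (Set.subset_univ _)) h1)
      (gr_mono (laurentForms_mono (Set.subset_univ _)) h2)) ?_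
    have := contr_mem_gr_laurent b (P' := Set.univ) hv (add_sub_cancel δ a)
      (fun _ _ _ _ => Set.mem_univ _) h3
    rwa [add_sub_cancel_right] at this

theorem coneE_mem {c : J → Laurent k n} (hc : ∀ i, c i ∈ laurentForms k n 0 (Set.Icc 0 n))
    {p a m : ℤ} {z : KoszulSpace k (Laurent k n) V × KoszulSpace k (Laurent k n) V ×
      KoszulSpace k (Laurent k n) V} (hz : z ∈ coneZ k V n δ p a m) :
    coneE b c z ∈ coneZ k V n δ (p + 1) a (m + n) := by
  obtain ⟨h1, h2, h3⟩ := hz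
  refine mem_coneZ.2 ⟨?_, ?_, neg_mem ?_⟩
  · refine vec_mul_mem_gr_laurent b hc (by ring) (fun i hi j hj => ?_) h1
    simp only [Set.mem_Icc, Set.mem_Ici] at *
    omega
  · refine vec_mul_mem_gr_laurent b hc (by ring) (fun i hi j hj => ?_) h2
    simp only [Set.mem_Icc, Set.mem_Iic] at *
    omega
  · exact vec_mul_mem_gr_laurent b hc (by ring) (fun _ _ _ _ => Set.mem_univ _) h3

theorem coneA_mem {u₀ u₁ : J → Laurent k n} (hu₀ : ∀ i, u₀ i ∈ laurentForms k n 0 (Set.Ici 0))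
    (hu₁ : ∀ i, u₁ i ∈ laurentForms k n 0 (Set.Iic (-n)))
    {p a m : ℤ} {z : KoszulSpace k (Laurent k n) V × KoszulSpace k (Laurent k n) V ×
      KoszulSpace k (Laurent k n) V} (hz : z ∈ coneZ k V n δ p a m) :
    coneA b u₀ u₁ z ∈ coneZ k V n δ (p - 1) a (m - n) := by
  obtain ⟨h1, h2, h3⟩ := hz
  refine mem_coneZ.2 ⟨?_, ?_, neg_mem ?_⟩
  · refine contr_mem_gr_laurent b hu₀ (by ring) (fun i hi j hj => ?_) h1
    simp only [Set.mem_Ici] at *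
    omega
  · refine contr_mem_gr_laurent b hu₁ (by ring) (fun i hi j hj => ?_) h2
    simp only [Set.mem_Iic] at *
    omega
  · have := contr_mem_gr_laurent b hu₀ (zero_add _) (P' := Set.univ)
      (fun _ _ _ _ => Set.mem_univ _) h3
    rwa [add_sub_cancel_right, ← sub_add_cancel p 1] at this

/-- The map `f` is onto in exterior degree `p`, and its kernel is spanned by the multiples of the
vectors `w l`; coefficients are controlled by `S` and `S''` in the source, `S'` in the target. -/
structure IsPresentation {R : Type*} [CommRing R] [Algebra k R]
    (f : KoszulSpace k R V →ₗ[k] KoszulSpace k R V') (w : L → J → R) (p : ℤ)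
    (S S' S'' : Submodule k R) : Prop where
  map_mem : ∀ x ∈ gr p S, f x ∈ gr p S'
  exists_eq : ∀ y ∈ gr p S', ∃ x ∈ gr p S, f x = y
  exists_ker : ∀ x ∈ gr p S, f x = 0 →
    ∃ ξ : L → KoszulSpace k R V, (∀ l, ξ l ∈ gr (p - 1) S'') ∧ x = ∑ l, vec b (w l) * ξ l

theorem exactMod_univ {v : J → Laurent k n} {w : L → J → Laurent k n}
    {v' : J' → MvPolynomial (Fin n) k}
    {f : KoszulSpace k (Laurent k n) V →ₗ[k] KoszulSpace k (Laurent k n) V'}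
    (hv : ∀ i, v i ∈ laurentForms k n δ (Set.Icc 0 δ))
    (hfd : ∀ x, f (contr b v x) = contr b' (fun i => LaurentPolynomial.C (v' i)) (f x))
    (hfw : ∀ l x, f (vec b (w l) * x) = 0)
    (h₀ : ∀ p a, IsPresentation b f w p (laurentForms k n a (Set.Ici 0))
      (laurentForms k n a (Set.Ici 0)) (laurentForms k n a (Set.Ici 0)))
    (h₁ : ∀ p a c, IsPresentation b f w p (laurentForms k n a (Set.Iic c))
      (laurentForms k n a (Set.Iic (c + p * δ))) (laurentForms k n a (Set.Iic (c - n))))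
    (h₂ : ∀ p a, IsPresentation b f w p (laurentForms k n a Set.univ)
      (laurentForms k n a Set.univ) (laurentForms k n a Set.univ)) {p a m : ℤ}
    (H : ∀ α ∈ gr (V := V') p (forms k n a), contr b' v' α = 0 →
      ∃ β ∈ gr (V := V') (p + 1) (forms k n (a - δ)), contr b' v' β = α)
    (H' : (∀ α ∈ gr (V := V') (p + 1) (forms k n (a - δ)), contr b' v' α = 0 →
      ∃ β ∈ gr (V := V') (p + 1 + 1) (forms k n (a - δ - δ)), contr b' v' β = α) ∨
        -1 ≤ a + p * δ + m) :
    ExactMod (coneD b v) (fun l => coneE b (w l)) (coneZ k V n δ) δ n Finset.univ p a m := by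
  intro z hz hDz
  have hker : f (coneD b v z).1 = 0 ∧ f (coneD b v z).2.1 = 0 ∧ f (coneD b v z).2.2 = 0 := by
    have : imageSum (fun l => coneE b (w l)) Finset.univ (coneZ k V n δ (p - 2) (a + δ) (m - n)) ≤
        (LinearMap.ker f).prod ((LinearMap.ker f).prod (LinearMap.ker f)) :=
      imageSum_le.2 fun l _ x _ =>
        ⟨hfw l _, hfw l _, by
          change f (-(vec b (w l) * x.2.2)) = 0
          rw [map_neg, hfw, neg_zero]⟩
    exact this hDz
  obtain ⟨α₀, α₁, γ⟩ := z
  obtain ⟨hα₀, hα₁, hγ⟩ := mem_coneZ.1 hz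
  simp only [coneD_apply, map_sub, hfd] at hker hα₀ hα₁ hγ
  obtain ⟨hd₀, hd₁, hdγ⟩ := hker
  obtain ⟨β₀, hβ₀, hβ₀'⟩ := exists_contr_eq_laurent b' H ((h₀ p a).map_mem _ hα₀) hd₀
  obtain ⟨β₁, hβ₁, hβ₁'⟩ := exists_contr_eq_laurent b' H ((h₁ p a _).map_mem _ hα₁) hd₁
  have hκ : contr b' (fun i => LaurentPolynomial.C (v' i)) (β₀ - β₁ - f γ) = 0 := by
    rw [map_sub, map_sub, hβ₀', hβ₁', hdγ]
  have hκ' : β₀ - β₁ - f γ ∈ gr (V := V') (p + 1) (laurentForms k n (a - δ) Set.univ) :=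
    sub_mem (sub_mem (gr_mono (laurentForms_mono (Set.subset_univ _)) hβ₀)
      (gr_mono (laurentForms_mono (Set.subset_univ _)) hβ₁)) ((h₂ _ _).map_mem _ hγ)
  obtain ⟨ζ₀, hζ₀, ζ₁, hζ₁, ε, hε, e₀, e₁, e₂⟩ :
      ∃ ζ₀ ∈ gr (V := V') (p + 1) (laurentForms k n (a - δ) (Set.Ici 0)),
      ∃ ζ₁ ∈ gr (V := V') (p + 1) (laurentForms k n (a - δ) (Set.Iic (a + m + p * δ))),
      ∃ ε ∈ gr (V := V') (p + 1 + 1) (laurentForms k n (a - δ - δ) Set.univ),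
        contr b' (fun i => LaurentPolynomial.C (v' i)) ζ₀ = f α₀ ∧
        contr b' (fun i => LaurentPolynomial.C (v' i)) ζ₁ = f α₁ ∧
        f γ = ζ₀ - ζ₁ - contr b' (fun i => LaurentPolynomial.C (v' i)) ε := by
    rcases H' with H' | H'
    · obtain ⟨ε, hε, hε'⟩ := exists_contr_eq_laurent b' H' hκ' hκ
      refine ⟨β₀, hβ₀, β₁, hβ₁, ε, hε, hβ₀', hβ₁', ?_⟩
      rw [hε']
      abel
    · set π := (tProj k n (Set.Ici 0)).rTensor (ExteriorAlgebra k V') with hπ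
      set κ := β₀ - β₁ - f γ with hκdef
      have hd : contr b' (fun i => LaurentPolynomial.C (v' i)) (π κ) = 0 := by
        rw [hπ, ← rTensor_contr b' (tProj k n (Set.Ici 0))
          (u := fun i => LaurentPolynomial.C (v' i)) fun i r => tProj_C_mul _ _ r, hκ, map_zero]
      have hπκ : π κ ∈ gr (V := V') (p + 1) (laurentForms k n (a - δ) (Set.Ici 0)) :=
        rTensor_mem_gr _ (fun s hs => laurentForms_mono Set.inter_subset_left (tProj_mem _ _ hs))
          hκ'
      have hπκ' : κ - π κ ∈
          gr (V := V') (p + 1) (laurentForms k n (a - δ) (Set.Iic (a + m + p * δ))) := by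
        have h := rTensor_mem_gr (V := V') (LinearMap.id - tProj k n (Set.Ici 0))
          (S' := laurentForms k n (a - δ) (Set.Iic (a + m + p * δ))) (fun s hs => ?_) hκ'
        · rwa [LinearMap.rTensor_sub, LinearMap.rTensor_id, LinearMap.sub_apply,
            LinearMap.id_apply] at h
        · refine laurentForms_mono ?_ (sub_tProj_mem (Set.Ici 0) _ hs)
          intro i hi
          simp only [Set.mem_sdiff, Set.mem_univ, Set.mem_Ici, true_and, Set.mem_Iic] at hi ⊢
          omega
      refine ⟨β₀ - π κ, sub_mem hβ₀ hπκ, β₁ + (κ - π κ), add_mem hβ₁ hπκ', 0, zero_mem _,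
        ?_, ?_, ?_⟩
      · rw [map_sub, hβ₀', hd, sub_zero]
      · rw [map_add, map_sub, hβ₁', hκ, hd, sub_zero, add_zero]
      · rw [map_zero, hκdef]
        abel
  obtain ⟨x₀, hx₀, hfx₀⟩ := (h₀ _ _).exists_eq ζ₀ hζ₀
  obtain ⟨x₁, hx₁, hfx₁⟩ := (h₁ (p + 1) (a - δ) (a - δ + m)).exists_eq ζ₁ (by
    rwa [show a - δ + m + (p + 1) * δ = a + m + p * δ by ring])
  obtain ⟨x₂, hx₂, hfx₂⟩ := (h₂ _ _).exists_eq ε hε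
  refine ⟨(x₀, x₁, x₂), mem_coneZ.2 ⟨hx₀, hx₁, hx₂⟩, ?_⟩
  have hmem : (α₀, α₁, γ) - coneD b v (x₀, x₁, x₂) ∈ coneZ k V n δ p a m := by
    have hx : (x₀, x₁, x₂) ∈ coneZ k V n δ (p + 1) (a - δ) m := mem_coneZ.2 ⟨hx₀, hx₁, hx₂⟩
    have := coneD_mem (δ := δ) b hv hx
    rw [add_sub_cancel_right, sub_add_cancel] at this
    exact sub_mem hz this
  obtain ⟨hm₀, hm₁, hm₂⟩ := mem_coneZ.1 hmem
  simp only [coneD_apply, Prod.mk_sub_mk] at hm₀ hm₁ hm₂ ⊢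
  obtain ⟨ξ₀, hξ₀, hξ₀'⟩ := (h₀ _ _).exists_ker _ hm₀ (by rw [map_sub, hfd, hfx₀, e₀, sub_self])
  obtain ⟨ξ₁, hξ₁, hξ₁'⟩ := (h₁ _ _ _).exists_ker _ hm₁ (by rw [map_sub, hfd, hfx₁, e₁, sub_self])
  obtain ⟨ξ₂, hξ₂, hξ₂'⟩ := (h₂ _ _).exists_ker _ hm₂ (by
    rw [map_sub, map_sub, map_sub, hfd, hfx₀, hfx₁, hfx₂, e₂, sub_self])
  have hsum : (α₀ - contr b v x₀, α₁ - contr b v x₁, γ - (x₀ - x₁ - contr b v x₂)) =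
      ∑ l, coneE b (w l) (ξ₀ l, ξ₁ l, -ξ₂ l) := by
    rw [hξ₀', hξ₁', hξ₂']
    simp only [coneE_apply, mul_neg, neg_neg]
    simp only [Prod.ext_iff, Prod.fst_sum, Prod.snd_sum, true_and]
  rw [hsum]
  refine sum_mem fun l _ => map_mem_imageSum (e := fun l => coneE b (w l)) (Finset.mem_univ l)
    (mem_coneZ.2 ⟨hξ₀ l, ?_, neg_mem ?_⟩)
  · have := hξ₁ l
    rwa [add_sub_assoc] at this
  · have := hξ₂ l
    rwa [add_sub_cancel_right, ← sub_add_cancel p 1] at this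

end LaurentCone

section Chart

/-- A hyperplane `F = 0` in a projective space, with coordinates `φ` on it and a
linear section `χ`, such that the section recovers all variables but one. -/
structure Chart (A : Type*) [CommRing A] (n : ℕ) where
  φ : MvPolynomial (Fin (n + 1)) A →ₐ[A] MvPolynomial (Fin n) A
  χ : MvPolynomial (Fin n) A →ₐ[A] MvPolynomial (Fin (n + 1)) A
  F : MvPolynomial (Fin (n + 1)) A
  i : Fin (n + 1)
  φ_χ_X : ∀ j, φ (χ (X j)) = X j
  φ_F : φ F = 0
  X_eq : ∀ j, X j = χ (φ (X j)) + if j = i then F else 0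
  φ_X : ∀ j, (φ (X j)).IsHomogeneous 1
  χ_X : ∀ j, (χ (X j)).IsHomogeneous 1
  isHomogeneous_F : F.IsHomogeneous 1
  F_ne_zero : F ≠ 0

theorem isHomogeneous_map_algHom {A σ τ : Type*} [CommRing A]
    (ψ : MvPolynomial σ A →ₐ[A] MvPolynomial τ A) (h : ∀ j, (ψ (X j)).IsHomogeneous 1)
    {f : MvPolynomial σ A} {m : ℕ} (hf : f.IsHomogeneous m) : (ψ f).IsHomogeneous m := by
  have := IsHomogeneous.aeval hf (fun j => ψ (X j)) (n := 1) h
  rwa [one_mul, show aeval (fun j => ψ (X j)) = ψ from (aeval_unique ψ).symm] at this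

variable {A : Type*} [CommRing A] {n : ℕ}

/-- The exponents of the monomials of degree `m` in `N` variables. -/
abbrev Exponent (N m : ℕ) : Type := {μ : Fin N →₀ ℕ // μ.degree = m}

instance (N m : ℕ) : Fintype (Exponent N m) :=
  @Fintype.ofFinite _ (Finsupp.finite_of_degree_eq m).to_subtype

theorem map_eq_sum_coeff {M : Type*} [AddCommMonoid M] [Module A M] {N m : ℕ}
    (Λ : MvPolynomial (Fin N) A →ₗ[A] M) {f : MvPolynomial (Fin N) A} (hf : f.IsHomogeneous m) :
    Λ f = ∑ μ : Exponent N m, coeff μ.1 f • Λ (monomial μ.1 1) := by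
  classical
  have h1 : f = ∑ μ : Exponent N m, coeff μ.1 f • monomial μ.1 1 := by
    ext ν
    simp only [coeff_sum, coeff_smul, coeff_monomial, smul_eq_mul, mul_ite, mul_one, mul_zero]
    by_cases hν : ν.degree = m
    · rw [Finset.sum_eq_single (⟨ν, hν⟩ : Exponent N m)]
      · simp
      · intro μ _ hμ
        rw [if_neg]
        rintro rfl
        exact hμ rfl
      · simp
    · rw [hf.coeff_eq_zero hν, Finset.sum_eq_zero]
      intro μ _
      rw [if_neg]
      rintro rfl
      exact hν μ.2
  conv_lhs => rw [h1]
  simp only [map_sum, map_smul]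

theorem monomial_isHomogeneous {N m : ℕ} (μ : Exponent N m) :
    (monomial μ.1 (1 : A)).IsHomogeneous m :=
  isHomogeneous_monomial _ μ.2

theorem exists_monomial_eq_X_mul {N m : ℕ} {μ : Fin N →₀ ℕ} (hμ : μ.degree = m + 1) :
    ∃ j, ∃ μ' : Fin N →₀ ℕ, μ'.degree = m ∧
      (monomial μ 1 : MvPolynomial (Fin N) A) = X j * monomial μ' 1 := by
  obtain ⟨j, hj⟩ : ∃ j, μ j ≠ 0 := by
    by_contra! hμ0
    have : μ = 0 := Finsupp.ext hμ0
    simp [this] at hμ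
  obtain ⟨μ', rfl⟩ : ∃ μ', μ = Finsupp.single j 1 + μ' :=
    ⟨μ - Finsupp.single j 1,
      (add_tsub_cancel_of_le (by simpa using Nat.one_le_iff_ne_zero.2 hj)).symm⟩
  refine ⟨j, μ', ?_, ?_⟩
  · rw [map_add, Finsupp.degree_single] at hμ
    omega
  · rw [X, monomial_mul, one_mul]

namespace Chart

variable (c : Chart A n)

theorem φ_χ (f : MvPolynomial (Fin n) A) : c.φ (c.χ f) = f := by
  have : c.φ.comp c.χ = AlgHom.id A _ := algHom_ext fun j => c.φ_χ_X j
  exact DFunLike.congr_fun this f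

theorem F_dvd (f : MvPolynomial (Fin (n + 1)) A) : c.F ∣ f - c.χ (c.φ f) := by
  have : Ideal.Quotient.mkₐ A (Ideal.span {c.F}) =
      (Ideal.Quotient.mkₐ A (Ideal.span {c.F})).comp (c.χ.comp c.φ) := by
    refine algHom_ext fun j => ?_
    conv_lhs => rw [c.X_eq j]
    simp only [map_add, AlgHom.comp_apply, add_eq_left]
    split_ifs
    · exact Ideal.Quotient.eq_zero_iff_mem.2 (Ideal.mem_span_singleton_self _)
    · exact map_zero _
  rw [← Ideal.mem_span_singleton, ← Ideal.Quotient.mk_eq_mk_iff_sub_mem]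
  exact DFunLike.congr_fun this f

theorem exists_quotient {m : ℕ} (μ : Fin (n + 1) →₀ ℕ) (hμ : μ.degree = m + 1) :
    ∃ g : MvPolynomial (Fin (n + 1)) A, g.IsHomogeneous m ∧
      monomial μ 1 = c.χ (c.φ (monomial μ 1)) + c.F * g := by
  have hone (j) : (if j = c.i then (1 : MvPolynomial (Fin (n + 1)) A) else 0).IsHomogeneous 0 := by
    split_ifs
    · exact isHomogeneous_one _ _
    · exact isHomogeneous_zero _ _ _
  have hX (j) : X j = c.χ (c.φ (X j)) + c.F * if j = c.i then 1 else 0 := by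
    simpa using c.X_eq j
  induction m generalizing μ with
  | zero =>
    obtain ⟨j, μ', hμ', hmul⟩ := exists_monomial_eq_X_mul (A := A) hμ
    obtain rfl : μ' = 0 := (Finsupp.degree_eq_zero_iff μ').1 hμ'
    rw [hmul, monomial_zero', C_1, mul_one]
    exact ⟨_, hone j, hX j⟩
  | succ m ih =>
    obtain ⟨j, μ', hμ', hmul⟩ := exists_monomial_eq_X_mul (A := A) hμ
    obtain ⟨g, hg, h⟩ := ih μ' hμ'
    refine ⟨(if j = c.i then 1 else 0) * monomial μ' 1 + c.χ (c.φ (X j)) * g, ?_, ?_⟩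
    · refine IsHomogeneous.add ?_ ?_
      · simpa using (hone j).mul (isHomogeneous_monomial (1 : A) hμ')
      · have := (isHomogeneous_map_algHom c.χ c.χ_X (c.φ_X j)).mul hg
        rwa [add_comm 1 m] at this
    · rw [hmul, map_mul, map_mul]
      linear_combination (monomial μ' 1 : MvPolynomial (Fin (n + 1)) A) * hX j +
        c.χ (c.φ (X j)) * h

/-- The quotients of the monomials of degree `m + 1` by the equation of the hyperplane. -/
def quotient {m : ℕ} (μ : Exponent (n + 1) (m + 1)) : MvPolynomial (Fin (n + 1)) A :=
  (c.exists_quotient μ.1 μ.2).choose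

theorem quotient_isHomogeneous {m : ℕ} (μ : Exponent (n + 1) (m + 1)) :
    (c.quotient μ).IsHomogeneous m :=
  (c.exists_quotient μ.1 μ.2).choose_spec.1

theorem monomial_eq {m : ℕ} (μ : Exponent (n + 1) (m + 1)) :
    monomial μ.1 1 = c.χ (c.φ (monomial μ.1 1)) + c.F * c.quotient μ :=
  (c.exists_quotient μ.1 μ.2).choose_spec.2

theorem F_mul_isHomogeneous {m : ℕ} {f : MvPolynomial (Fin (n + 1)) A} (hf : f.IsHomogeneous m) :
    (c.F * f).IsHomogeneous (m + 1) :=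
  add_comm 1 m ▸ c.isHomogeneous_F.mul hf

theorem sum_smul_quotient [IsDomain A] {m : ℕ} {f : MvPolynomial (Fin (n + 1)) A}
    (hf : f.IsHomogeneous m) :
    ∑ μ : Exponent (n + 1) (m + 1), coeff μ.1 (c.F * f) • c.quotient μ = f := by
  have hFf := c.F_mul_isHomogeneous hf
  refine mul_left_cancel₀ c.F_ne_zero ?_
  have h1 := map_eq_sum_coeff (LinearMap.id - (c.χ.comp c.φ).toLinearMap) hFf
  simp only [LinearMap.sub_apply, LinearMap.id_apply, AlgHom.toLinearMap_apply, AlgHom.comp_apply,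
    map_mul, c.φ_F, map_zero, zero_mul, sub_zero] at h1
  rw [Finset.mul_sum]
  refine (h1.trans (Finset.sum_congr rfl fun μ _ => ?_)).symm
  rw [mul_smul_comm, sub_eq_of_eq_add' (c.monomial_eq μ)]

/-- The matrix of `φ` in degree `m`. -/
def mapCoeff (m : ℕ) (μ : Exponent (n + 1) m) (ν : Exponent n m) : A :=
  coeff ν.1 (c.φ (monomial μ.1 1))

/-- The matrix of `χ` in degree `m`. -/
def sectionCoeff (m : ℕ) (ν : Exponent n m) (μ : Exponent (n + 1) m) : A :=
  coeff μ.1 (c.χ (monomial ν.1 1))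

/-- The matrix of the multiplication by `F` from degree `m` to degree `m + 1`. -/
def mulCoeff (m : ℕ) (l : Exponent (n + 1) m) (μ : Exponent (n + 1) (m + 1)) : A :=
  coeff μ.1 (c.F * monomial l.1 1)

/-- The matrix of the division by `F` from degree `m + 1` to degree `m`. -/
def quotientCoeff (m : ℕ) (l : Exponent (n + 1) m) (μ : Exponent (n + 1) (m + 1)) : A :=
  coeff l.1 (c.quotient μ)

theorem coeff_monomial_eq_single {N m : ℕ} (μ μ' : Exponent N m) :
    coeff μ'.1 (monomial μ.1 (1 : A)) = (Pi.single μ 1 : Exponent N m → A) μ' := by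
  classical
  rw [coeff_monomial, Pi.single_apply]
  simp only [Subtype.ext_iff, eq_comm]

theorem coeff_map_eq_sum {N N' m : ℕ} (ψ : MvPolynomial (Fin N) A →ₗ[A] MvPolynomial (Fin N') A)
    {f : MvPolynomial (Fin N) A} (hf : f.IsHomogeneous m) (ν : Fin N' →₀ ℕ) :
    coeff ν (ψ f) = ∑ μ : Exponent N m, coeff μ.1 f * coeff ν (ψ (monomial μ.1 1)) := by
  rw [map_eq_sum_coeff ψ hf, coeff_sum]
  rfl

theorem sectionCoeff_mul_mapCoeff (m : ℕ) (ν ν' : Exponent n m) :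
    ∑ μ, c.sectionCoeff m ν μ * c.mapCoeff m μ ν' = (Pi.single ν 1 : Exponent n m → A) ν' := by
  have h := coeff_map_eq_sum c.φ.toLinearMap
    (isHomogeneous_map_algHom c.χ c.χ_X (monomial_isHomogeneous ν)) ν'.1
  rw [AlgHom.toLinearMap_apply, c.φ_χ, coeff_monomial_eq_single] at h
  exact h.symm

theorem mapCoeff_mul_sectionCoeff_add (m : ℕ) (μ μ' : Exponent (n + 1) (m + 1)) :
    (∑ ν, c.mapCoeff (m + 1) μ ν * c.sectionCoeff (m + 1) ν μ') +
      ∑ l, c.quotientCoeff m l μ * c.mulCoeff m l μ' =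
        (Pi.single μ 1 : Exponent (n + 1) (m + 1) → A) μ' := by
  have h1 := coeff_map_eq_sum c.χ.toLinearMap
    (isHomogeneous_map_algHom c.φ c.φ_X (monomial_isHomogeneous μ)) μ'.1
  have h2 := coeff_map_eq_sum (LinearMap.mulLeft A c.F) (c.quotient_isHomogeneous μ) μ'.1
  rw [← coeff_monomial_eq_single, c.monomial_eq μ, coeff_add]
  exact (congrArg₂ (· + ·) h1 h2).symm

theorem mulCoeff_mul_mapCoeff (m : ℕ) (l : Exponent (n + 1) m) (ν : Exponent n (m + 1)) :
    ∑ μ, c.mulCoeff m l μ * c.mapCoeff (m + 1) μ ν = 0 := by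
  have hFf := c.F_mul_isHomogeneous (monomial_isHomogeneous l)
  have h := coeff_map_eq_sum c.φ.toLinearMap hFf ν.1
  rw [AlgHom.toLinearMap_apply, map_mul, c.φ_F, zero_mul, coeff_zero] at h
  exact h.symm

theorem quotientCoeff_mul_mulCoeff [IsDomain A] (m : ℕ) (l l' : Exponent (n + 1) m) :
    ∑ μ, c.quotientCoeff m l' μ * c.mulCoeff m l μ =
      (Pi.single l 1 : Exponent (n + 1) m → A) l' := by
  rw [← coeff_monomial_eq_single, ← c.sum_smul_quotient (monomial_isHomogeneous l), coeff_sum]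
  exact Finset.sum_congr rfl fun μ _ => mul_comm _ _

/-- The chart obtained by reversing the order of the variables. -/
def rev (c : Chart A n) : Chart A n where
  φ := (rename Fin.rev).comp (c.φ.comp (rename Fin.rev))
  χ := (rename Fin.rev).comp (c.χ.comp (rename Fin.rev))
  F := rename Fin.rev c.F
  i := c.i.rev
  φ_χ_X j := by
    simp [rename_rename, Fin.rev_involutive.comp_self, c.φ_χ_X]
  φ_F := by
    simp [rename_rename, Fin.rev_involutive.comp_self, c.φ_F]
  X_eq j := by
    have h := congrArg (rename Fin.rev) (c.X_eq j.rev)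
    simp only [AlgHom.comp_apply, rename_X, rename_rename, Fin.rev_involutive.comp_self,
      rename_id_apply, map_add, Fin.rev_rev, apply_ite, map_zero, Fin.rev_eq_iff] at h ⊢
    exact h
  φ_X j := by
    simpa using (c.φ_X j.rev).rename_isHomogeneous
  χ_X j := by
    simpa using (c.χ_X j.rev).rename_isHomogeneous
  isHomogeneous_F := c.isHomogeneous_F.rename_isHomogeneous
  F_ne_zero h := c.F_ne_zero (rename_injective _ Fin.rev_injective (h.trans (map_zero _).symm))

end Chart

/-- The variable number `j`, or `0` if there is no such variable. -/
def natX (A : Type*) [CommRing A] (N j : ℕ) : MvPolynomial (Fin N) A :=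
  if h : j < N then X ⟨j, h⟩ else 0

theorem natX_coe {N : ℕ} (j : Fin N) : natX A N j = X j := by
  simp [natX]

theorem natX_of_le {N j : ℕ} (h : N ≤ j) : natX A N j = 0 :=
  dif_neg (not_lt.2 h)

theorem natX_isHomogeneous (N j : ℕ) : (natX A N j).IsHomogeneous 1 := by
  rw [natX]
  split_ifs
  · exact isHomogeneous_X _ _
  · exact isHomogeneous_zero _ _ _

/-- The partial sums `∑ i ≤ j, (-τ) ^ (j - i) x_i`. -/
def partialSum (τ : A) (N : ℕ) : ℕ → MvPolynomial (Fin N) A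
  | 0 => natX A N 0
  | j + 1 => natX A N (j + 1) - C τ * partialSum τ N j

theorem partialSum_eq_sum (τ : A) (N j : ℕ) : partialSum τ N j =
    ∑ i ∈ Finset.range (j + 1), C ((-τ) ^ (j - i)) * natX A N i := by
  induction j with
  | zero => simp [partialSum]
  | succ j ih =>
    rw [partialSum, ih, Finset.sum_range_succ _ (j + 1), Nat.sub_self, pow_zero, C_1, one_mul,
      Finset.mul_sum, sub_eq_neg_add, ← Finset.sum_neg_distrib]
    congr 1
    refine Finset.sum_congr rfl fun i hi => ?_
    rw [Nat.succ_sub (Finset.mem_range_succ_iff.1 hi), pow_succ', C_mul, C_neg]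
    ring

theorem partialSum_isHomogeneous (τ : A) (N j : ℕ) : (partialSum τ N j).IsHomogeneous 1 := by
  rw [partialSum_eq_sum]
  exact IsHomogeneous.sum _ _ _ fun i _ => (natX_isHomogeneous N i).C_mul _

/-- The images of the variables in the standard chart. -/
def chartImage (τ : A) (n : ℕ) : ℕ → MvPolynomial (Fin n) A
  | 0 => natX A n 0
  | j + 1 => natX A n (j + 1) + C τ * natX A n j

theorem chartImage_isHomogeneous (τ : A) (n j : ℕ) : (chartImage τ n j).IsHomogeneous 1 := by
  cases j with
  | zero => exact natX_isHomogeneous _ _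
  | succ j => exact (natX_isHomogeneous _ _).add ((natX_isHomogeneous _ _).C_mul _)

theorem aeval_natX (τ : A) (n j : ℕ) (hj : j ≤ n) :
    aeval (fun j : Fin (n + 1) => chartImage τ n j) (natX A (n + 1) j) = chartImage τ n j := by
  rw [natX, dif_pos (Nat.lt_succ_of_le hj), aeval_X]

theorem aeval_partialSum (τ : A) (n j : ℕ) (hj : j ≤ n) :
    aeval (fun j : Fin (n + 1) => chartImage τ n j) (partialSum τ (n + 1) j) = natX A n j := by
  induction j with
  | zero => exact aeval_natX τ n 0 hj
  | succ j ih =>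
    rw [partialSum, map_sub, map_mul, ih (by omega), aeval_natX τ n _ hj, algHom_C,
      algebraMap_eq, chartImage, add_sub_cancel_right]

theorem aeval_partialSum_natX (τ : A) (n j : ℕ) (hj : j < n) :
    aeval (fun j : Fin n => partialSum τ (n + 1) j) (natX A n j) = partialSum τ (n + 1) j := by
  rw [natX, dif_pos hj, aeval_X]

theorem natX_eq (τ : A) (n j : ℕ) (hj : j ≤ n) : natX A (n + 1) j =
    aeval (fun j : Fin n => partialSum τ (n + 1) j) (chartImage τ n j) +
      if j = n then partialSum τ (n + 1) n else 0 := by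
  rcases hj.eq_or_lt with rfl | hj
  · rw [if_pos rfl]
    cases j with
    | zero => simp [chartImage, natX_of_le, partialSum]
    | succ j =>
      rw [chartImage, natX_of_le le_rfl, zero_add, map_mul, algHom_C, algebraMap_eq,
        aeval_partialSum_natX _ _ _ (by omega)]
      simp [partialSum]
  · rw [if_neg hj.ne, add_zero]
    cases j with
    | zero => rw [chartImage, aeval_partialSum_natX _ _ _ hj, partialSum]
    | succ j =>
      rw [chartImage, map_add, map_mul, algHom_C, algebraMap_eq, aeval_partialSum_natX _ _ _ hj,
        aeval_partialSum_natX _ _ _ (by omega), partialSum, sub_add_cancel]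

theorem coeff_partialSum (τ : A) (n : ℕ) :
    coeff (Finsupp.single (Fin.last n) 1) (partialSum τ (n + 1) n) = 1 := by
  classical
  rw [partialSum_eq_sum, coeff_sum, Finset.sum_eq_single n]
  · rw [coeff_C_mul, natX, dif_pos (Nat.lt_succ_self n)]
    simp only [tsub_self, pow_zero, one_mul]
    exact (coeff_X _ _).trans (if_pos rfl)
  · intro i hi hin
    have hi' : i < n + 1 := Finset.mem_range.1 hi
    rw [coeff_C_mul, natX, dif_pos hi', coeff_X, if_neg, mul_zero]
    intro h
    have := (Finsupp.single_left_inj one_ne_zero).1 h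
    exact hin (congrArg Fin.val this)
  · intro h
    exact absurd (Finset.self_mem_range_succ n) h

/-- The chart `x_j ↦ y_j + τ y_{j-1}`. -/
def stdChart (τ : A) [Nontrivial A] (n : ℕ) : Chart A n where
  φ := aeval fun j : Fin (n + 1) => chartImage τ n j
  χ := aeval fun j : Fin n => partialSum τ (n + 1) j
  F := partialSum τ (n + 1) n
  i := Fin.last n
  φ_χ_X j := by rw [aeval_X, aeval_partialSum _ _ _ j.2.le, natX_coe]
  φ_F := by rw [aeval_partialSum _ _ _ le_rfl, natX_of_le le_rfl]
  X_eq j := by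
    rw [aeval_X, ← natX_coe, natX_eq τ n j (Fin.is_le j)]
    simp only [Fin.ext_iff, Fin.val_last]
  φ_X j := by
    rw [aeval_X]
    exact chartImage_isHomogeneous _ _ _
  χ_X j := by
    rw [aeval_X]
    exact partialSum_isHomogeneous _ _ _
  isHomogeneous_F := partialSum_isHomogeneous _ _ _
  F_ne_zero h := by
    have := coeff_partialSum τ n
    rw [h, coeff_zero] at this
    exact zero_ne_one this

end Chart

section TwoCharts

variable {A B : Type*} [CommRing A] [CommRing B]

theorem map_natX (e : A →+* B) (N j : ℕ) : map e (natX A N j) = natX B N j := by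
  rw [natX, natX]
  split_ifs <;> simp

theorem map_chartImage (e : A →+* B) (τ : A) (n j : ℕ) :
    map e (chartImage τ n j) = chartImage (e τ) n j := by
  cases j <;> simp [chartImage, map_natX]

theorem map_partialSum (e : A →+* B) (τ : A) (N j : ℕ) :
    map e (partialSum τ N j) = partialSum (e τ) N j := by
  induction j with
  | zero => simp [partialSum, map_natX]
  | succ j ih => simp [partialSum, map_natX, ih]

theorem rename_rev_natX {m j j' : ℕ} (h : j + j' = m) :
    rename Fin.rev (natX A (m + 1) j) = natX A (m + 1) j' := by
  rw [natX, natX, dif_pos (by omega), dif_pos (by omega), rename_X]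
  congr 1
  ext
  simp only [Fin.val_rev]
  omega

theorem chartImage_eq_rename_rev {τ τ' : A} (h : τ * τ' = 1) {n j j' : ℕ} (hj : j + j' = n) :
    chartImage τ n j = C τ * rename Fin.rev (chartImage τ' n j') := by
  have hC : (C τ * C τ' : MvPolynomial (Fin n) A) = 1 := by rw [← C_mul, h, C_1]
  rcases j with _ | j <;> rcases j' with _ | j'
  · obtain rfl : n = 0 := by omega
    simp [chartImage, natX_of_le]
  · obtain rfl : n = j' + 1 := by omega
    rw [chartImage, chartImage, natX_of_le le_rfl, zero_add, map_mul, algHom_C, algebraMap_eq,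
      rename_rev_natX (add_zero j'), ← mul_assoc, hC, one_mul]
  · obtain rfl : n = j + 1 := by omega
    rw [chartImage, chartImage, natX_of_le le_rfl, zero_add, rename_rev_natX (zero_add j)]
  · obtain rfl : n = j + j' + 1 + 1 := by omega
    rw [chartImage, chartImage, map_add, map_mul, algHom_C, algebraMap_eq,
      rename_rev_natX (show j' + 1 + j = j + j' + 1 by omega),
      rename_rev_natX (show j' + (j + 1) = j + j' + 1 by omega)]
    linear_combination (-natX A (j + j' + 1 + 1) (j + 1)) * hC

theorem partialSum_eq_rename_rev {τ τ' : A} (h : τ * τ' = 1) (n : ℕ) :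
    partialSum τ (n + 1) n = C ((-τ) ^ n) * rename Fin.rev (partialSum τ' (n + 1) n) := by
  rw [partialSum_eq_sum, partialSum_eq_sum, map_sum, Finset.mul_sum, ← Finset.sum_range_reflect]
  refine Finset.sum_congr rfl fun i hi => ?_
  have hi' : i ≤ n := Finset.mem_range_succ_iff.1 hi
  have h1 : (-τ) ^ (n - i) * (-τ') ^ (n - i) = 1 := by
    rw [← mul_pow, neg_mul_neg, h, one_pow]
  have h2 : (-τ) ^ n = (-τ) ^ i * (-τ) ^ (n - i) := by rw [← pow_add, Nat.add_sub_cancel' hi']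
  rw [map_mul, algHom_C, algebraMap_eq, rename_rev_natX (show i + (n + 1 - 1 - i) = n by omega),
    ← mul_assoc, ← C_mul, show n - (n + 1 - 1 - i) = i by omega, h2, mul_assoc, h1, mul_one]

variable [Nontrivial A] {e₀ e₁ : A →+* B} {τ : A}

theorem map_φ_monomial (h : e₀ τ * e₁ τ = 1) {n m : ℕ} (μ : Fin (n + 1) →₀ ℕ) (hμ : μ.degree = m) :
    map e₀ ((stdChart τ n).φ (monomial μ 1)) =
      C (e₀ τ ^ m) * map e₁ ((stdChart τ n).rev.φ (monomial μ 1)) := by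
  induction m generalizing μ with
  | zero =>
    obtain rfl : μ = 0 := (Finsupp.degree_eq_zero_iff μ).1 hμ
    simp
  | succ m ih =>
    obtain ⟨j, μ', hμ', hmul⟩ := exists_monomial_eq_X_mul (A := A) hμ
    have hX : map e₀ ((stdChart τ n).φ (X j)) =
        C (e₀ τ) * map e₁ ((stdChart τ n).rev.φ (X j)) := by
      simp only [stdChart, Chart.rev, AlgHom.comp_apply, rename_X, aeval_X, map_rename,
        map_chartImage]
      refine chartImage_eq_rename_rev h ?_
      rw [Fin.val_rev]
      omega
    rw [hmul, map_mul, map_mul, map_mul, map_mul, ih μ' hμ', hX, pow_succ, C_mul]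
    ring

theorem map_F (h : e₀ τ * e₁ τ = 1) (n : ℕ) :
    map e₀ (stdChart τ n).F = C ((-e₀ τ) ^ n) * map e₁ (stdChart τ n).rev.F := by
  simp only [stdChart, Chart.rev, map_rename, map_partialSum]
  exact partialSum_eq_rename_rev h n

theorem mapCoeff_eq (h : e₀ τ * e₁ τ = 1) {n m : ℕ} (μ : Exponent (n + 1) m) (ν : Exponent n m) :
    e₀ ((stdChart τ n).mapCoeff m μ ν) = e₀ τ ^ m * e₁ ((stdChart τ n).rev.mapCoeff m μ ν) := by
  rw [Chart.mapCoeff, ← coeff_map, map_φ_monomial h μ.1 μ.2, coeff_C_mul, coeff_map]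
  rfl

theorem mulCoeff_eq (h : e₀ τ * e₁ τ = 1) {n m : ℕ} (l : Exponent (n + 1) m)
    (μ : Exponent (n + 1) (m + 1)) : e₀ ((stdChart τ n).mulCoeff m l μ) =
      (-1) ^ n * e₀ τ ^ n * e₁ ((stdChart τ n).rev.mulCoeff m l μ) := by
  rw [Chart.mulCoeff, ← coeff_map, map_mul, map_F h, map_monomial, map_one e₀, mul_assoc,
    coeff_C_mul, Chart.mulCoeff, ← coeff_map, map_mul, map_monomial, map_one e₁, neg_pow]

end TwoCharts

section LaurentCharts

open LaurentPolynomial hiding C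

variable (k : Type*) [Field k] (n : ℕ)

/-- The evaluation of polynomials at `t`. -/
def evalT : Polynomial k →ₐ[k] Laurent k n := Polynomial.aeval (T 1)

/-- The evaluation of polynomials at `t⁻¹`. -/
def evalTInv : Polynomial k →ₐ[k] Laurent k n := Polynomial.aeval (T (-1))

theorem evalT_X : evalT k n Polynomial.X = T 1 := Polynomial.aeval_X _

theorem evalTInv_X : evalTInv k n Polynomial.X = T (-1) := Polynomial.aeval_X _

theorem evalT_mul_evalTInv :
    (evalT k n : Polynomial k →+* Laurent k n) Polynomial.X *
      (evalTInv k n : Polynomial k →+* Laurent k n) Polynomial.X = 1 := by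
  simp only [RingHom.coe_coe, evalT_X, evalTInv_X, ← T_add]
  simp

variable {k n}

theorem aeval_T_mem {i : ℤ} {P : Set ℤ} (hP : ∀ j : ℕ, j * i ∈ P) (f : Polynomial k) :
    Polynomial.aeval (T i : Laurent k n) f ∈ laurentForms k n 0 P := by
  rw [Polynomial.aeval_eq_sum_range]
  refine sum_mem fun j _ => Submodule.smul_mem _ _ ?_
  rw [T_pow]
  exact laurentForms_mono (Set.singleton_subset_iff.2 (hP j)) (T_mem_laurentForms _)

theorem evalT_mem (f : Polynomial k) : evalT k n f ∈ laurentForms k n 0 (Set.Ici 0) :=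
  aeval_T_mem (fun j => by simp) f

theorem evalTInv_mem (f : Polynomial k) : evalTInv k n f ∈ laurentForms k n 0 (Set.Iic 0) :=
  aeval_T_mem (fun j => by simp) f

theorem mem_laurentForms_inter {a : ℤ} {P P' : Set ℤ} {r : Laurent k n}
    (h : r ∈ laurentForms k n a P) (h' : r ∈ laurentForms k n a P') :
    r ∈ laurentForms k n a (P ∩ P') := by
  rw [← tProj_eq_self h]
  exact tProj_mem P P' h'

variable (k n)

/-- The first chart of the projective bundle. -/
def chart₀ : Chart (Polynomial k) n := stdChart Polynomial.X n

/-- The second chart of the projective bundle. -/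
def chart₁ : Chart (Polynomial k) n := (chart₀ k n).rev

variable (m : ℕ)

/-- The matrix of the map from forms in `n + 1` variables to forms in `n` variables. -/
def presMap (μ : Exponent (n + 1) (m + 1)) (ν : Exponent n (m + 1)) : Laurent k n :=
  evalT k n ((chart₀ k n).mapCoeff (m + 1) μ ν)

/-- The vectors spanning the kernel of `presMap`. -/
def presKer (l : Exponent (n + 1) m) (μ : Exponent (n + 1) (m + 1)) : Laurent k n :=
  evalT k n ((chart₀ k n).mulCoeff m l μ)

variable {k n m}

theorem presMap_eq (μ : Exponent (n + 1) (m + 1)) (ν : Exponent n (m + 1)) :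
    presMap k n m μ ν =
      T ((m + 1 : ℕ) : ℤ) * evalTInv k n ((chart₁ k n).mapCoeff (m + 1) μ ν) := by
  have := mapCoeff_eq (evalT_mul_evalTInv k n) μ ν
  simp only [RingHom.coe_coe, evalT_X, T_pow, mul_one] at this
  exact this

theorem presKer_eq (l : Exponent (n + 1) m) (μ : Exponent (n + 1) (m + 1)) :
    presKer k n m l μ =
      (-1) ^ n * T (n : ℤ) * evalTInv k n ((chart₁ k n).mulCoeff m l μ) := by
  have := mulCoeff_eq (evalT_mul_evalTInv k n) l μ
  simp only [RingHom.coe_coe, evalT_X, T_pow, mul_one] at this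
  exact this

theorem presMap_mem (μ : Exponent (n + 1) (m + 1)) (ν : Exponent n (m + 1)) :
    presMap k n m μ ν ∈ laurentForms k n 0 (Set.Icc 0 (m + 1 : ℕ)) := by
  rw [← Set.Ici_inter_Iic]
  refine mem_laurentForms_inter (evalT_mem _) ?_
  rw [presMap_eq]
  refine mul_mem_laurentForms (add_zero 0) (fun i hi j hj => ?_) (T_mem_laurentForms _)
    (evalTInv_mem _)
  simp only [Set.mem_singleton_iff, Set.mem_Iic] at *
  omega

theorem neg_one_pow_mul_mem {a : ℤ} {P : Set ℤ} {r : Laurent k n} (h : r ∈ laurentForms k n a P)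
    (j : ℕ) : (-1) ^ j * r ∈ laurentForms k n a P := by
  rcases neg_one_pow_eq_or (Laurent k n) j with h1 | h1 <;> rw [h1]
  · rwa [one_mul]
  · rw [neg_one_mul]
    exact neg_mem h

theorem presKer_mem (l : Exponent (n + 1) m) (μ : Exponent (n + 1) (m + 1)) :
    presKer k n m l μ ∈ laurentForms k n 0 (Set.Icc 0 n) := by
  rw [← Set.Ici_inter_Iic]
  refine mem_laurentForms_inter (evalT_mem _) ?_
  rw [presKer_eq, mul_assoc]
  refine neg_one_pow_mul_mem (mul_mem_laurentForms (add_zero 0) (fun i hi j hj => ?_)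
    (T_mem_laurentForms _) (evalTInv_mem _)) n
  simp only [Set.mem_singleton_iff, Set.mem_Iic] at *
  omega

theorem presKer_mul_presMap (l : Exponent (n + 1) m) (ν : Exponent n (m + 1)) :
    ∑ μ, presKer k n m l μ * presMap k n m μ ν = 0 := by
  simp only [presKer, presMap, ← map_mul, ← map_sum, Chart.mulCoeff_mul_mapCoeff, map_zero]

end LaurentCharts

section Presentation

open LaurentPolynomial hiding C

variable {k V V' R : Type*} [Field k] [AddCommGroup V] [Module k V] [AddCommGroup V'] [Module k V']
  [CommRing R] [Algebra k R] {n m : ℕ} (b : Module.Basis (Exponent (n + 1) (m + 1)) k V)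
  (b' : Module.Basis (Exponent n (m + 1)) k V')

theorem Chart.isPresentation (c : Chart (Polynomial k) n) (e : Polynomial k →ₐ[k] R) (p : ℤ)
    {S : Submodule k R} (hS : ∀ f, ∀ s ∈ S, e f * s ∈ S) :
    IsPresentation b
      ((extHom b b' fun μ ν => e (c.mapCoeff (m + 1) μ ν)).toLinearMap.restrictScalars k)
      (fun l μ => e (c.mulCoeff m l μ)) p S S S where
  map_mem x hx := extHom_mem_gr b b' (fun _ _ => hS _) hx
  exists_eq y hy := by
    refine ⟨extHom b' b (fun ν μ => e (c.sectionCoeff (m + 1) ν μ)) y,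
      extHom_mem_gr b' b (fun _ _ => hS _) hy, ?_⟩
    simp only [LinearMap.coe_restrictScalars, AlgHom.toLinearMap_apply, extHom_extHom, ← map_mul,
      ← map_sum, c.sectionCoeff_mul_mapCoeff]
    convert extHom_one b' y using 3
    ext ν ν'
    rw [Pi.single_apply, Pi.single_apply]
    split_ifs <;> simp
  exists_ker x hx hfx := by
    obtain ⟨ξ, hξ, h⟩ := exists_sub_extHom_eq b b' (c := fun μ ν => e (c.mapCoeff (m + 1) μ ν))
      (s := fun ν μ => e (c.sectionCoeff (m + 1) ν μ)) (q := fun l μ => e (c.quotientCoeff m l μ))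
      (w := fun l μ => e (c.mulCoeff m l μ)) (fun μ μ' => by
        simp only [← map_mul, ← map_sum, ← map_add, c.mapCoeff_mul_sectionCoeff_add]
        rw [Pi.single_apply, Pi.single_apply]
        split_ifs <;> simp) (fun _ _ => hS _) (fun _ _ => hS _) (fun _ _ => hS _) hx
    refine ⟨ξ, hξ, ?_⟩
    change extHom b b' _ x = 0 at hfx
    rwa [hfx, map_zero, sub_zero] at h

end Presentation

section BundleDescent

open LaurentPolynomial hiding C

variable {k V V' : Type*} [Field k] [AddCommGroup V] [Module k V] [AddCommGroup V'] [Module k V']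
  {n m : ℕ} (b : Module.Basis (Exponent (n + 1) (m + 1)) k V)
  (b' : Module.Basis (Exponent n (m + 1)) k V')

/-- The cycles of exterior degree `p` with coefficients of degree `a` in the Koszul complex
on the forms `v` of degree `δ` are boundaries. -/
def KoszulExact {N : ℕ} {J : Type*} [Fintype J] (b : Module.Basis J k V)
    (v : J → MvPolynomial (Fin N) k) (δ p a : ℤ) : Prop :=
  ∀ α ∈ gr (V := V) p (forms k N a), contr b v α = 0 →
    ∃ β ∈ gr (V := V) (p + 1) (forms k N (a - δ)), contr b v β = α

/-- The map `presMap` on exterior algebras. -/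
def presHom : KoszulSpace k (Laurent k n) V →ₗ[k] KoszulSpace k (Laurent k n) V' :=
  (extHom b b' (presMap k n m)).toLinearMap.restrictScalars k

theorem presHom_apply (x : KoszulSpace k (Laurent k n) V) :
    presHom b b' x = extHom b b' (presMap k n m) x := rfl

theorem presHom_vec_mul (l : Exponent (n + 1) m) (x : KoszulSpace k (Laurent k n) V) :
    presHom b b' (vec b (presKer k n m l) * x) = 0 := by
  have : vec b' (0 : Exponent n (m + 1) → Laurent k n) = 0 := by
    rw [← zero_smul (Laurent k n) 0, vec_smul, zero_smul]
  rw [presHom_apply, map_mul, extHom_vec]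
  simp only [presKer_mul_presMap]
  change vec b' (0 : Exponent n (m + 1) → Laurent k n) * _ = 0
  rw [this, zero_mul]

theorem evalT_mul_mem {a : ℤ} {P : Set ℤ} (hP : ∀ i ∈ Set.Ici (0 : ℤ), ∀ j ∈ P, i + j ∈ P)
    (f : Polynomial k) (s : Laurent k n) (hs : s ∈ laurentForms k n a P) :
    evalT k n f * s ∈ laurentForms k n a P :=
  mul_mem_laurentForms (zero_add a) hP (evalT_mem f) hs

theorem isPresentation_of_nonneg (p a : ℤ) {P : Set ℤ}
    (hP : ∀ i ∈ Set.Ici (0 : ℤ), ∀ j ∈ P, i + j ∈ P) :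
    IsPresentation b (presHom b b') (presKer k n m) p (laurentForms k n a P)
      (laurentForms k n a P) (laurentForms k n a P) :=
  (chart₀ k n).isPresentation b b' (evalT k n) p (evalT_mul_mem hP)

theorem T_smul_mem_gr (j : ℤ) {a c c' p : ℤ} (h : j + c = c') {x : KoszulSpace k (Laurent k n) V}
    (hx : x ∈ gr p (laurentForms k n a (Set.Iic c))) :
    (T j : Laurent k n) • x ∈ gr (V := V) p (laurentForms k n a (Set.Iic c')) := by
  refine smul_mem_gr (fun s hs => mul_mem_laurentForms (zero_add a) (fun i hi i' hi' => ?_)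
    (T_mem_laurentForms j) hs) hx
  simp only [Set.mem_singleton_iff, Set.mem_Iic] at *
  omega

theorem T_smul_T_smul {j j' : ℤ} (h : j + j' = 0) (x : KoszulSpace k (Laurent k n) V) :
    (T j : Laurent k n) • (T j' : Laurent k n) • x = x := by
  rw [smul_smul, ← T_add, h, T_zero, one_smul]

theorem neg_one_pow_smul_mem {V : Type*} [AddCommGroup V] [Module k V]
    {N : Submodule k (KoszulSpace k (Laurent k n) V)}
    {x : KoszulSpace k (Laurent k n) V} (hx : x ∈ N) (j : ℕ) :
    ((-1) ^ j : Laurent k n) • x ∈ N := by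
  rcases neg_one_pow_eq_or (Laurent k n) j with h | h <;> rw [h]
  · rwa [one_smul]
  · rw [neg_smul, one_smul]
    exact neg_mem hx

theorem neg_one_pow_mul_T_mul (N : ℕ) {j j' : ℤ} (h : j + j' = 0) :
    ((-1) ^ N * T j : Laurent k n) * ((-1) ^ N * T j') = 1 := by
  have h1 : ((-1) ^ N * (-1) ^ N : Laurent k n) = 1 := by
    rcases neg_one_pow_eq_or (Laurent k n) N with h | h <;> rw [h]
    · rw [one_mul]
    · rw [neg_one_mul, neg_neg]
  rw [mul_mul_mul_comm, h1, ← T_add, h, T_zero, one_mul]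

theorem isPresentation_Iic (p a c : ℤ) :
    IsPresentation b (presHom b b') (presKer k n m) p (laurentForms k n a (Set.Iic c))
      (laurentForms k n a (Set.Iic (c + p * (m + 1 : ℕ))))
      (laurentForms k n a (Set.Iic (c - n))) := by
  rcases lt_or_ge p 0 with hp | hp
  · refine ⟨fun x hx => ?_, fun y hy => ?_, fun x hx _ => ?_⟩
    · rw [gr_of_neg hp, Submodule.mem_bot] at hx
      rw [hx, map_zero]
      exact zero_mem _
    · rw [gr_of_neg hp, Submodule.mem_bot] at hy
      exact ⟨0, zero_mem _, by rw [hy, map_zero]⟩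
    · rw [gr_of_neg hp, Submodule.mem_bot] at hx
      exact ⟨0, fun _ => zero_mem _, by simp [hx]⟩
  lift p to ℕ using hp
  have h1 := (chart₁ k n).isPresentation b b' (evalTInv k n) p
    (S := laurentForms k n a (Set.Iic c))
    (fun f s hs => mul_mem_laurentForms (zero_add a) (fun i hi j hj => by
      simp only [Set.mem_Iic] at *
      omega) (evalTInv_mem f) hs)
  set f₁ := (extHom b b' fun μ ν =>
    evalTInv k n ((chart₁ k n).mapCoeff (m + 1) μ ν)).toLinearMap.restrictScalars k with hf₁
  have hf : ∀ x ∈ gr (V := V) (p : ℤ) (laurentForms k n a (Set.Iic c)),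
      presHom b b' x = (T (p * (m + 1 : ℕ) : ℤ) : Laurent k n) • f₁ x := fun x hx => by
    have h2 : presMap k n m = fun μ ν => T ((m + 1 : ℕ) : ℤ) *
        evalTInv k n ((chart₁ k n).mapCoeff (m + 1) μ ν) := funext₂ presMap_eq
    rw [presHom_apply, h2, extHom_smul_of_mem_gr b b' _ _ hx, T_pow]
    rfl
  refine ⟨fun x hx => ?_, fun y hy => ?_, fun x hx hfx => ?_⟩
  · rw [hf x hx]
    exact T_smul_mem_gr _ (add_comm _ _) (h1.map_mem x hx)
  · obtain ⟨x, hx, hfx⟩ := h1.exists_eq ((T (-(p * (m + 1 : ℕ)) : ℤ) : Laurent k n) • y)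
      (T_smul_mem_gr _ (by ring) hy)
    exact ⟨x, hx, by rw [hf x hx, hfx, T_smul_T_smul (add_neg_cancel _)]⟩
  · obtain ⟨ξ, hξ, h⟩ := h1.exists_ker x hx (by
      rw [← T_smul_T_smul (neg_add_cancel (p * (m + 1 : ℕ) : ℤ)) (f₁ x), ← hf x hx, hfx, smul_zero])
    refine ⟨fun l => ((-1) ^ n : Laurent k n) • (T (-n : ℤ) : Laurent k n) • ξ l,
      fun l => neg_one_pow_smul_mem (T_smul_mem_gr _ (by ring) (hξ l)) n, ?_⟩
    rw [h]
    refine Finset.sum_congr rfl fun l _ => ?_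
    have h2 : presKer k n m l = ((-1) ^ n * T (n : ℤ) : Laurent k n) •
        fun μ => evalTInv k n ((chart₁ k n).mulCoeff m l μ) := funext (presKer_eq l)
    simp only [h2, vec_smul, smul_smul, smul_mul_smul_comm,
      neg_one_pow_mul_T_mul n (add_neg_cancel (n : ℤ)), one_smul]

/-- The images of the monomials of degree `m + 1` on the projective bundle. -/
def presForm (k : Type*) [Field k] (n m : ℕ) (μ : Exponent (n + 1) (m + 1)) : Laurent k n :=
  ∑ ν : Exponent n (m + 1), presMap k n m μ ν * LaurentPolynomial.C (monomial ν.1 1)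

theorem presForm_mem (μ : Exponent (n + 1) (m + 1)) :
    presForm k n m μ ∈ laurentForms k n (m + 1 : ℕ) (Set.Icc 0 (m + 1 : ℕ)) := by
  refine sum_mem fun ν _ => ?_
  have h := monomial_mem_forms (N := n) ν.1 (1 : k)
  rw [ν.2] at h
  refine mul_mem_laurentForms (zero_add _) (fun i hi j hj => ?_) (presMap_mem μ ν)
    (C_mem_laurentForms h)
  rw [Set.mem_singleton_iff.1 hj, add_zero]
  exact hi

theorem presForm_mul_presKer (l : Exponent (n + 1) m) :
    ∑ μ, presForm k n m μ * presKer k n m l μ = 0 := by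
  have (μ : Exponent (n + 1) (m + 1)) : presForm k n m μ * presKer k n m l μ =
      ∑ ν : Exponent n (m + 1), (presKer k n m l μ * presMap k n m μ ν) *
        LaurentPolynomial.C (monomial ν.1 1) := by
    rw [presForm, Finset.sum_mul]
    exact Finset.sum_congr rfl fun ν _ => by ring
  simp only [this]
  rw [Finset.sum_comm]
  refine Finset.sum_eq_zero fun ν _ => ?_
  rw [← Finset.sum_mul, presKer_mul_presMap, zero_mul]

theorem presHom_contr (x : KoszulSpace k (Laurent k n) V) :
    presHom b b' (contr b (presForm k n m) x) =
      contr b' (fun ν => LaurentPolynomial.C (monomial ν.1 1)) (presHom b b' x) :=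
  (contr_extHom b b' _ _ _ (fun _ => rfl) x).symm

/-- The functionals dual to the vectors `presKer` on the first chart. -/
def presDual₀ (k : Type*) [Field k] (n m : ℕ) (l : Exponent (n + 1) m)
    (μ : Exponent (n + 1) (m + 1)) : Laurent k n :=
  evalT k n ((chart₀ k n).quotientCoeff m l μ)

/-- The functionals dual to the vectors `presKer` on the second chart. -/
def presDual₁ (k : Type*) [Field k] (n m : ℕ) (l : Exponent (n + 1) m)
    (μ : Exponent (n + 1) (m + 1)) : Laurent k n :=
  (-1) ^ n * (T (-n : ℤ) * evalTInv k n ((chart₁ k n).quotientCoeff m l μ))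

theorem presDual₀_mul_presKer (l l' : Exponent (n + 1) m) :
    ∑ μ, presDual₀ k n m l' μ * presKer k n m l μ =
      (Pi.single l 1 : Exponent (n + 1) m → Laurent k n) l' := by
  simp only [presDual₀, presKer, ← map_mul, ← map_sum, Chart.quotientCoeff_mul_mulCoeff]
  rw [Pi.single_apply, Pi.single_apply]
  split_ifs <;> simp

theorem presDual₁_mul_presKer (l l' : Exponent (n + 1) m) :
    ∑ μ, presDual₁ k n m l' μ * presKer k n m l μ =
      (Pi.single l 1 : Exponent (n + 1) m → Laurent k n) l' := by
  have (μ : Exponent (n + 1) (m + 1)) : presDual₁ k n m l' μ * presKer k n m l μ =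
      evalTInv k n ((chart₁ k n).quotientCoeff m l' μ * (chart₁ k n).mulCoeff m l μ) := by
    rw [presDual₁, presKer_eq, map_mul, ← mul_assoc ((-1) ^ n), mul_mul_mul_comm,
      neg_one_pow_mul_T_mul n (neg_add_cancel (n : ℤ)), one_mul]
  simp only [this, ← map_sum, Chart.quotientCoeff_mul_mulCoeff]
  rw [Pi.single_apply, Pi.single_apply]
  split_ifs <;> simp

theorem exactMod_empty {a : ℤ} {P : ℤ → ℤ → Prop} (hP : ∀ p c, P p c → P (p - 1) (c - n))
    (hleaf : ∀ p c, P p c →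
      KoszulExact b' (fun ν => monomial ν.1 1) (m + 1 : ℕ) p a ∧
        (KoszulExact b' (fun ν => monomial ν.1 1) (m + 1 : ℕ) (p + 1) (a - (m + 1 : ℕ)) ∨
          -1 ≤ a + p * (m + 1 : ℕ) + c)) {p c : ℤ} (h : P p c) :
    ExactMod (coneD b (presForm k n m)) (fun l => coneE b (presKer k n m l))
      (coneZ k V n (m + 1 : ℕ)) (m + 1 : ℕ) n ∅ p a c := by
  classical
  refine exactMod_empty_of_univ (A := fun l => coneA b (presDual₀ k n m l) (presDual₁ k n m l))
    (fun p a c z hz => coneD_mem b presForm_mem hz)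
    (fun l p a c z hz => coneE_mem b (presKer_mem l) hz)
    (fun l p a c z hz => coneA_mem b (fun _ => evalT_mem _) (fun μ => ?_) hz)
    (coneD_coneD b _) (fun l z => coneD_coneE b (presForm_mul_presKer l) z)
    (fun l l' z => coneE_coneE b _ _ z) (fun l z => coneE_coneE_self b _ z)
    (fun l z => ?_) (fun l l' z hl => ?_) hP (fun p c hpc => ?_) h
  · refine neg_one_pow_mul_mem (mul_mem_laurentForms (zero_add 0) (fun i hi j hj => ?_)
      (T_mem_laurentForms _) (evalTInv_mem _)) n
    simp only [Set.mem_singleton_iff, Set.mem_Iic] at *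
    omega
  · have := coneA_coneE_add b (presDual₀_mul_presKer (k := k) l l) (presDual₁_mul_presKer l l) z
    rwa [Pi.single_eq_same, one_smul] at this
  · have := coneA_coneE_add b (presDual₀_mul_presKer (k := k) l' l) (presDual₁_mul_presKer l' l) z
    rwa [Pi.single_eq_of_ne hl, zero_smul] at this
  · obtain ⟨h1, h2⟩ := hleaf p c hpc
    exact exactMod_univ b b' presForm_mem (presHom_contr b b') (presHom_vec_mul b b')
      (fun p a => isPresentation_of_nonneg b b' p a fun i hi j hj =>
        add_nonneg (Set.mem_Ici.1 hi) (Set.mem_Ici.1 hj))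
      (isPresentation_Iic b b')
      (fun p a => isPresentation_of_nonneg b b' p a fun _ _ _ _ => Set.mem_univ _) h1 h2

end BundleDescent

section BundleMap

open LaurentPolynomial hiding C

variable (k : Type*) [Field k] (n : ℕ)

/-- Polynomials with coefficients in `k[τ]` as polynomials in `τ`. -/
def toPolynomial : MvPolynomial (Fin n) (Polynomial k) →+* Polynomial (MvPolynomial (Fin n) k) :=
  eval₂Hom (Polynomial.mapRingHom C) fun j => Polynomial.C (X j)

variable {k n}

theorem toPolynomial_C (f : Polynomial k) :
    toPolynomial k n (C f) = f.map C := by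
  simp [toPolynomial]

theorem toPolynomial_X (j : Fin n) : toPolynomial k n (X j) = Polynomial.C (X j) := by
  simp [toPolynomial]

theorem toPolynomial_natX (j : ℕ) :
    toPolynomial k n (natX (Polynomial k) n j) = Polynomial.C (natX k n j) := by
  rw [natX, natX]
  split_ifs <;> simp [toPolynomial_X]

theorem toPolynomial_map_C (f : MvPolynomial (Fin n) k) :
    toPolynomial k n (MvPolynomial.map Polynomial.C f) = Polynomial.C f := by
  induction f using MvPolynomial.induction_on with
  | C a => simp [toPolynomial_C]
  | add f g hf hg => simp only [map_add, hf, hg]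
  | mul_X f j hf => simp only [map_mul, map_X, hf, toPolynomial_X]

theorem toPolynomial_monomial_one (ν : Fin n →₀ ℕ) :
    toPolynomial k n (monomial ν 1) = Polynomial.C (monomial ν 1) := by
  rw [← toPolynomial_map_C, map_monomial, Polynomial.C_1]

theorem coeff_coeff_toPolynomial (f : MvPolynomial (Fin n) (Polynomial k)) (ν : Fin n →₀ ℕ)
    (j : ℕ) : coeff ν ((toPolynomial k n f).coeff j) = (coeff ν f).coeff j := by
  classical
  induction f using MvPolynomial.induction_on' with
  | monomial μ p =>
    have : monomial μ p = C p * monomial μ 1 := by rw [C_mul_monomial, mul_one]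
    rw [this, map_mul, toPolynomial_C, toPolynomial_monomial_one, Polynomial.coeff_mul_C,
      Polynomial.coeff_map, coeff_C_mul, coeff_C_mul, coeff_monomial, coeff_monomial]
    split_ifs <;> simp
  | add f g hf hg => simp only [map_add, Polynomial.coeff_add, coeff_add, hf, hg]

theorem toPolynomial_injective : Function.Injective (toPolynomial k n) := fun f g h => by
  ext ν j
  rw [← coeff_coeff_toPolynomial, h, coeff_coeff_toPolynomial]

theorem toLaurent_map_C (f : Polynomial k) :
    Polynomial.toLaurent (f.map (C : k →+* MvPolynomial (Fin n) k)) = evalT k n f := by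
  induction f using Polynomial.induction_on' with
  | add f g hf hg => simp only [Polynomial.map_add, map_add, hf, hg]
  | monomial j a =>
    rw [Polynomial.map_monomial, Polynomial.toLaurent_C_mul_T, evalT, Polynomial.aeval_monomial,
      T_pow, mul_one]
    rfl

variable (k n) in
/-- The restriction of polynomials in `n + 1` variables to the projective bundle. -/
def bundleMap : MvPolynomial (Fin (n + 1)) k →ₐ[k] Laurent k n :=
  aeval fun j : Fin (n + 1) =>
    Polynomial.toLaurent (toPolynomial k n (chartImage Polynomial.X n j))

theorem bundleMap_eq (f : MvPolynomial (Fin (n + 1)) k) :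
    bundleMap k n f =
      Polynomial.toLaurent (toPolynomial k n ((chart₀ k n).φ (map Polynomial.C f))) := by
  induction f using MvPolynomial.induction_on with
  | C a =>
    rw [map_C, algHom_C, algHom_C, algebraMap_eq, toPolynomial_C, Polynomial.map_C,
      Polynomial.toLaurent_C]
    rfl
  | add f g hf hg => simp only [map_add, hf, hg]
  | mul_X f j hf =>
    simp only [map_mul, hf, map_X]
    congr 1
    simp only [bundleMap, chart₀, stdChart, aeval_X]

theorem bundleMap_natX_zero :
    bundleMap k n (natX k (n + 1) 0) = LaurentPolynomial.C (natX k n 0) := by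
  rw [natX, dif_pos (Nat.succ_pos n), bundleMap, aeval_X, chartImage, toPolynomial_natX,
    Polynomial.toLaurent_C]

theorem bundleMap_natX_succ {j : ℕ} (hj : j < n) : bundleMap k n (natX k (n + 1) (j + 1)) =
    LaurentPolynomial.C (natX k n (j + 1)) + T 1 * LaurentPolynomial.C (natX k n j) := by
  rw [natX, dif_pos (Nat.succ_lt_succ hj), bundleMap, aeval_X, chartImage, map_add, map_mul,
    toPolynomial_natX, toPolynomial_natX, toPolynomial_C, Polynomial.map_X, map_add, map_mul,
    Polynomial.toLaurent_C, Polynomial.toLaurent_C, Polynomial.toLaurent_X]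

theorem presForm_eq {m : ℕ} (μ : Exponent (n + 1) (m + 1)) :
    presForm k n m μ = bundleMap k n (monomial μ.1 1) := by
  have h := map_eq_sum_coeff LinearMap.id (isHomogeneous_map_algHom (chart₀ k n).φ
    (chart₀ k n).φ_X (monomial_isHomogeneous μ))
  simp only [LinearMap.id_apply] at h
  rw [bundleMap_eq, map_monomial, map_one, h, map_sum, map_sum, presForm]
  refine Finset.sum_congr rfl fun ν _ => ?_
  rw [MvPolynomial.smul_eq_C_mul, map_mul, map_mul, toPolynomial_C, toPolynomial_monomial_one,
    Polynomial.toLaurent_C, toLaurent_map_C]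
  rfl

theorem toPolynomial_partialSum : toPolynomial k (n + 1) (partialSum Polynomial.X (n + 1) n) =
    ∑ i ∈ Finset.range (n + 1),
      Polynomial.C ((-1) ^ (n - i) * natX k (n + 1) i) * Polynomial.X ^ (n - i) := by
  rw [partialSum_eq_sum, map_sum]
  refine Finset.sum_congr rfl fun i _ => ?_
  rw [map_mul, toPolynomial_C, toPolynomial_natX, neg_pow]
  simp only [Polynomial.map_mul, Polynomial.map_pow, Polynomial.map_neg, Polynomial.map_one,
    Polynomial.map_X, map_mul, map_pow, map_neg, map_one]
  ring

theorem natDegree_toPolynomial_partialSum :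
    (toPolynomial k (n + 1) (partialSum Polynomial.X (n + 1) n)).natDegree = n := by
  rw [toPolynomial_partialSum]
  refine le_antisymm (Polynomial.natDegree_sum_le_of_forall_le _ _ fun i _ =>
    (Polynomial.natDegree_C_mul_X_pow_le _ _).trans (Nat.sub_le n i))
    (Polynomial.le_natDegree_of_ne_zero ?_)
  rw [Polynomial.finsetSum_coeff, Finset.sum_eq_single 0]
  · rw [Nat.sub_zero, Polynomial.coeff_C_mul_X_pow, if_pos rfl, natX, dif_pos (Nat.succ_pos n)]
    exact mul_ne_zero (pow_ne_zero _ (neg_ne_zero.2 one_ne_zero)) (X_ne_zero _)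
  · intro i hi hi0
    have hi' := Finset.mem_range.1 hi
    rw [Polynomial.coeff_C_mul_X_pow, if_neg (by omega)]
  · simp

variable (k n) in
/-- The sum `∑ i < n, tⁱ fᵢ` of restrictions to the projective bundle. -/
def bundleSum : (Fin n → MvPolynomial (Fin (n + 1)) k) →ₗ[k] Laurent k n :=
  ∑ i : Fin n, (LinearMap.mulLeft k (T (i : ℤ))) ∘ₗ (bundleMap k n).toLinearMap ∘ₗ LinearMap.proj i

theorem bundleSum_apply (f : Fin n → MvPolynomial (Fin (n + 1)) k) :
    bundleSum k n f = ∑ i : Fin n, T (i : ℤ) * bundleMap k n (f i) := by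
  simp [bundleSum]

theorem bundleSum_mul (f : MvPolynomial (Fin (n + 1)) k)
    (g : Fin n → MvPolynomial (Fin (n + 1)) k) :
    bundleSum k n ((fun _ => f) * g) = bundleMap k n f * bundleSum k n g := by
  rw [bundleSum_apply, bundleSum_apply, Finset.mul_sum]
  refine Finset.sum_congr rfl fun i _ => ?_
  rw [Pi.mul_apply, map_mul]
  ring

theorem bundleSum_injective : Function.Injective (bundleSum k n) := by
  rw [← LinearMap.ker_eq_bot, LinearMap.ker_eq_bot']
  intro f hf
  set G : MvPolynomial (Fin (n + 1)) (Polynomial k) :=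
    ∑ i : Fin n, C (Polynomial.X ^ (i : ℕ)) * MvPolynomial.map Polynomial.C (f i) with hG
  have h1 : (chart₀ k n).φ G = 0 := by
    refine toPolynomial_injective (Polynomial.toLaurent_injective ?_)
    rw [map_zero, map_zero, ← hf, bundleSum_apply, hG, map_sum, map_sum, map_sum]
    refine Finset.sum_congr rfl fun i _ => ?_
    rw [bundleMap_eq, map_mul, map_mul, map_mul, algHom_C, algebraMap_eq, toPolynomial_C,
      toLaurent_map_C, map_pow, evalT_X, T_pow, mul_one]
  obtain ⟨H, hH⟩ := (chart₀ k n).F_dvd G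
  rw [h1, map_zero, sub_zero] at hH
  have h2 : toPolynomial k (n + 1) G =
      ∑ i : Fin n, Polynomial.C (f i) * Polynomial.X ^ (i : ℕ) := by
    rw [hG, map_sum]
    refine Finset.sum_congr rfl fun i _ => ?_
    rw [map_mul, toPolynomial_C, toPolynomial_map_C, Polynomial.map_pow, Polynomial.map_X, mul_comm]
  have h3 : toPolynomial k (n + 1) G = 0 := by
    by_contra h0
    have hdeg : (toPolynomial k (n + 1) G).degree < n := h2 ▸ Polynomial.degree_sum_fin_lt f
    rw [hH, map_mul] at h0 hdeg
    have hF := left_ne_zero_of_mul h0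
    rw [Polynomial.degree_mul, Polynomial.degree_eq_natDegree hF] at hdeg
    have hn : (toPolynomial k (n + 1) (chart₀ k n).F).natDegree = n :=
      natDegree_toPolynomial_partialSum
    rw [hn, Polynomial.degree_eq_natDegree (right_ne_zero_of_mul h0)] at hdeg
    norm_cast at hdeg
    omega
  ext1 j
  have h4 := congrArg (fun g => g.coeff (j : ℕ)) (h2.symm.trans h3)
  simp only [Polynomial.finsetSum_coeff, Polynomial.coeff_C_mul_X_pow, Polynomial.coeff_zero] at h4
  rwa [Finset.sum_eq_single j, if_pos rfl] at h4
  · exact fun i _ hij => if_neg fun h => hij (Fin.ext h.symm)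
  · exact fun h => absurd (Finset.mem_univ j) h

end BundleMap

section Descent

open LaurentPolynomial hiding C

variable {k V : Type*} [Field k] [AddCommGroup V] [Module k V] {n : ℕ}

variable (k n) in
/-- The image of `∑ i < n, tⁱ fᵢ` for forms `fᵢ` of degree `a`. -/
def bundleForms (a : ℤ) : Submodule k (Laurent k n) :=
  (Submodule.pi Set.univ fun _ : Fin n => forms k (n + 1) a).map (bundleSum k n)

theorem natX_mem_forms (N j : ℕ) : natX k N j ∈ forms k N 1 := by
  rw [natX]
  split_ifs
  · exact X_mem_forms _
  · exact zero_mem _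

theorem bundleMap_natX_mul_mem {a : ℤ} {j : ℕ} {r : Laurent k n} (hr : r ∈ bundleForms k n a) :
    bundleMap k n (natX k (n + 1) j) * r ∈ bundleForms k n (a + 1) := by
  obtain ⟨g, hg, rfl⟩ := hr
  rw [← bundleSum_mul]
  refine Submodule.mem_map_of_mem fun i _ => ?_
  rw [add_comm a]
  exact mul_mem_forms (natX_mem_forms _ _) (hg i trivial)

theorem C_mul_T_mem_bundleForms (a : ℕ) : ∀ f ∈ forms k n a, ∀ j ∈ Set.Ico (0 : ℤ) (a + n),
    LaurentPolynomial.C f * T j ∈ bundleForms k n a := by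
  induction a with
  | zero =>
    intro f hf j hj
    lift j to ℕ using hj.1
    have hj' : j < n := by simpa using hj.2
    have : forms k n 0 ≤ (bundleForms k n 0).comap
        ((LinearMap.mulRight k (T (j : ℤ))) ∘ₗ tMonomial k n 0) := forms_zero_le ?_
    · simpa [tMonomial_apply] using this hf
    rw [Submodule.mem_comap]
    refine ⟨Pi.single ⟨j, hj'⟩ 1, fun i _ => ?_, ?_⟩
    · rcases eq_or_ne i ⟨j, hj'⟩ with rfl | h
      · rw [Pi.single_eq_same]
        exact one_mem_forms
      · rw [Pi.single_eq_of_ne h]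
        exact zero_mem _
    · rw [bundleSum_apply, Finset.sum_eq_single ⟨j, hj'⟩]
      · simp [tMonomial_apply]
      · intro i _ h
        rw [Pi.single_eq_of_ne h, map_zero, mul_zero]
      · exact fun h => absurd (Finset.mem_univ _) h
  | succ a ih =>
    intro f hf j hj
    push_cast at hf hj ⊢
    have : forms k n (a + 1) ≤ (bundleForms k n (a + 1)).comap
        ((LinearMap.mulRight k (T j)) ∘ₗ tMonomial k n 0) :=
      forms_succ_le (Int.natCast_nonneg a) fun i g hg => ?_
    · simpa [tMonomial_apply] using this hf
    have h0 : ∀ l ∈ Set.Ico (0 : ℤ) (a + n), LaurentPolynomial.C (natX k n 0 * g) * T l ∈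
        bundleForms k n (a + 1) := fun l hl => by
      have := bundleMap_natX_mul_mem (j := 0) (ih g hg l hl)
      rwa [bundleMap_natX_zero, ← mul_assoc, ← map_mul] at this
    have h1 : ∀ i < n, ∀ l ∈ Set.Ico (0 : ℤ) (a + n),
        LaurentPolynomial.C (natX k n (i + 1) * g) * T l +
          LaurentPolynomial.C (natX k n i * g) * T (l + 1) ∈ bundleForms k n (a + 1) :=
      fun i hi l hl => by
        have := bundleMap_natX_mul_mem (j := i + 1) (ih g hg l hl)
        rw [bundleMap_natX_succ hi] at this
        convert this using 1
        rw [map_mul, map_mul, add_comm l 1, T_add]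
        ring
    have hlow : ∀ i < n, ∀ l ∈ Set.Ico (0 : ℤ) (a + n - i),
        LaurentPolynomial.C (natX k n i * g) * T l ∈ bundleForms k n (a + 1) := by
      intro i
      induction i with
      | zero => exact fun _ l hl => h0 l (by simpa using hl)
      | succ i ihi =>
        intro hi l hl
        have hl' : 0 ≤ l ∧ l < a + n - ((i + 1 : ℕ) : ℤ) := hl
        refine ((bundleForms k n (a + 1)).add_mem_iff_left
          (ihi (by omega) (l + 1) ⟨by omega, by omega⟩)).1
          (h1 i (by omega) l ⟨by omega, by omega⟩)
    have hhigh : ∀ i' i : ℕ, i + i' = n → ∀ l ∈ Set.Ico (i' : ℤ) (a + n + 1),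
        LaurentPolynomial.C (natX k n i * g) * T l ∈ bundleForms k n (a + 1) := by
      intro i'
      induction i' with
      | zero =>
        intro i hi l hl
        rw [natX_of_le (show n ≤ i by omega), zero_mul, map_zero, zero_mul]
        exact zero_mem _
      | succ i' ihi =>
        intro i hi l hl
        have hl' : ((i' + 1 : ℕ) : ℤ) ≤ l ∧ l < a + n + 1 := hl
        have := h1 i (by omega) (l - 1) ⟨by omega, by omega⟩
        rw [sub_add_cancel] at this
        exact ((bundleForms k n (a + 1)).add_mem_iff_right
          (ihi (i + 1) (by omega) (l - 1) ⟨by omega, by omega⟩)).1 this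
    have hj' : 0 ≤ j ∧ j < a + 1 + n := hj
    simp only [Submodule.mem_comap, LinearMap.comp_apply, tMonomial_apply, T_zero, mul_one,
      LinearMap.mulRight_apply, ← natX_coe]
    rcases lt_or_ge j (a + n - (i : ℕ)) with h | h
    · exact hlow i i.2 j ⟨hj'.1, h⟩
    · have := i.2
      exact hhigh (n - i) i (by omega) j ⟨by omega, by omega⟩

theorem laurentForms_le_bundleForms {a : ℤ} (ha : 0 ≤ a) :
    laurentForms k n a (Set.Ico 0 (a + n)) ≤ bundleForms k n a := by
  lift a to ℕ using ha
  exact laurentForms_le.2 (C_mul_T_mem_bundleForms a)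

theorem bundleMap_mem {a : ℤ} (ha : 0 ≤ a) {f : MvPolynomial (Fin (n + 1)) k}
    (hf : f ∈ forms k (n + 1) a) : bundleMap k n f ∈ laurentForms k n a (Set.Icc 0 a) := by
  have hX : ∀ j : Fin (n + 1), bundleMap k n (X j) ∈ laurentForms k n 1 (Set.Icc 0 1) := by
    intro j
    rw [← natX_coe]
    obtain ⟨_ | j, hj⟩ := j
    · simp only
      rw [bundleMap_natX_zero]
      exact laurentForms_mono (by simp) (C_mem_laurentForms (natX_mem_forms _ _))
    · simp only
      rw [bundleMap_natX_succ (by omega)]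
      refine add_mem (laurentForms_mono (by simp) (C_mem_laurentForms (natX_mem_forms _ _))) ?_
      refine mul_mem_laurentForms (zero_add 1) (fun i hi j hj => ?_) (T_mem_laurentForms 1)
        (C_mem_laurentForms (natX_mem_forms _ _))
      rw [Set.mem_singleton_iff.1 hi, Set.mem_singleton_iff.1 hj]
      simp
  lift a to ℕ using ha
  suffices forms k (n + 1) a ≤
      (laurentForms k n a (Set.Icc 0 a)).comap (bundleMap k n).toLinearMap from this hf
  clear hf
  induction a with
  | zero =>
    refine forms_zero_le ?_
    simpa using (T_mem_laurentForms (k := k) (n := n) 0)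
  | succ a ih =>
    push_cast
    refine forms_succ_le (Int.natCast_nonneg a) fun i g hg => ?_
    rw [Submodule.mem_comap, AlgHom.toLinearMap_apply, map_mul]
    refine mul_mem_laurentForms (add_comm _ _) (fun i hi j hj => ?_) (hX i) (ih hg)
    simp only [Set.mem_Icc] at *
    omega

/-- A cycle on the projective space is the boundary if its restriction to the projective bundle
is the boundary of an element with small pole order. -/
theorem exists_contr_eq_of_bundle {J : Type*} [Fintype J] (b : Module.Basis J k V)
    {v : J → MvPolynomial (Fin (n + 1)) k} (hn : 0 < n) {p a : ℤ} (ha : 0 ≤ a)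
    {α : KoszulSpace k (MvPolynomial (Fin (n + 1)) k) V} {β : KoszulSpace k (Laurent k n) V}
    (hβ : β ∈ gr p (laurentForms k n a (Set.Ico 0 (a + n))))
    (h : contr b (fun i => bundleMap k n (v i)) β =
      (bundleMap k n).toLinearMap.rTensor (ExteriorAlgebra k V) α) :
    ∃ γ ∈ gr p (forms k (n + 1) a), contr b v γ = α := by
  have h1 : gr p (laurentForms k n a (Set.Ico 0 (a + n))) ≤
      (gr p (Submodule.pi Set.univ fun _ : Fin n => forms k (n + 1) a)).map
        ((bundleSum k n).rTensor (ExteriorAlgebra k V)) := by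
    refine (gr_mono (laurentForms_le_bundleForms ha)).trans (gr_le.2 ?_)
    rintro _ ⟨g, hg, rfl⟩ y hy
    exact ⟨g ⊗ₜ y, tmul_mem_gr hg hy, LinearMap.rTensor_tmul _ _ _ _⟩
  obtain ⟨γ, hγ, rfl⟩ := h1 hβ
  let i₀ : Fin n := ⟨0, hn⟩
  have h2 : bundleSum k n ∘ₗ LinearMap.single k (fun _ => MvPolynomial (Fin (n + 1)) k) i₀ =
      (bundleMap k n).toLinearMap := by
    refine LinearMap.ext fun f => ?_
    rw [LinearMap.comp_apply, bundleSum_apply, Finset.sum_eq_single i₀]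
    · simp [i₀]
    · intro i _ hi
      rw [LinearMap.single_apply, Pi.single_eq_of_ne hi, map_zero, mul_zero]
    · exact fun h => absurd (Finset.mem_univ _) h
  have h3 : contr b (fun i _ => v i) γ =
      (LinearMap.single k (fun _ => MvPolynomial (Fin (n + 1)) k) i₀).rTensor
        (ExteriorAlgebra k V) α := by
    refine Module.Flat.rTensor_preserves_injective_linearMap (M := ExteriorAlgebra k V)
      (bundleSum k n) bundleSum_injective ?_
    rw [rTensor_contr b (bundleSum k n) (u' := fun i => bundleMap k n (v i))
      (fun i r => bundleSum_mul _ _), h, ← h2, LinearMap.rTensor_comp, LinearMap.comp_apply]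
  refine ⟨(LinearMap.proj (R := k) (φ := fun _ => MvPolynomial (Fin (n + 1)) k) i₀).rTensor
    (ExteriorAlgebra k V) γ, rTensor_mem_gr
      (S := Submodule.pi Set.univ fun _ => forms k (n + 1) a) _
      (fun s hs => hs i₀ (Set.mem_univ i₀)) hγ, ?_⟩
  rw [← rTensor_contr b (LinearMap.proj (R := k) (φ := fun _ => MvPolynomial (Fin (n + 1)) k) i₀)
    (u := fun i _ => v i) (fun i r => rfl), h3, ← LinearMap.comp_apply, ← LinearMap.rTensor_comp]
  have : LinearMap.proj i₀ ∘ₗ LinearMap.single k (fun _ => MvPolynomial (Fin (n + 1)) k) i₀ =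
      LinearMap.id := LinearMap.ext fun f => by simp
  rw [this, LinearMap.rTensor_id, LinearMap.id_apply]

theorem mem_gr_inter {p a : ℤ} {P P' : Set ℤ} {x : KoszulSpace k (Laurent k n) V}
    (h : x ∈ gr p (laurentForms k n a P)) (h' : x ∈ gr p (laurentForms k n a P')) :
    x ∈ gr (V := V) p (laurentForms k n a (P ∩ P')) := by
  have h1 : (tProj k n P).rTensor (ExteriorAlgebra k V) x = x := by
    rw [rTensor_eq_of_mem_gr (ψ' := LinearMap.id) (fun s hs => tProj_eq_self hs) h,
      LinearMap.rTensor_id, LinearMap.id_apply]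
  rw [← h1]
  exact rTensor_mem_gr _ (fun s hs => tProj_mem P P' hs) h'

theorem koszulExact_of_exactMod {m : ℕ} (b : Module.Basis (Exponent (n + 1) (m + 1)) k V)
    (hn : 0 < n) {p a : ℤ} (ha : 2 * (m + 1 : ℕ) ≤ a)
    (H : ExactMod (coneD b (presForm k n m)) (fun l => coneE b (presKer k n m l))
      (coneZ k V n (m + 1 : ℕ)) (m + 1 : ℕ) n ∅ p a (n - 1)) :
    KoszulExact b (fun μ => monomial μ.1 1) (m + 1 : ℕ) p a := by
  intro α hα hdα
  have hform : presForm k n m = fun μ => bundleMap k n (monomial μ.1 1) := funext presForm_eq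
  set φα : KoszulSpace k (Laurent k n) V :=
    (bundleMap k n).toLinearMap.rTensor (ExteriorAlgebra k V) α with hφα
  have hφ : φα ∈ gr p (laurentForms k n a (Set.Icc 0 a)) :=
    rTensor_mem_gr _ (fun s hs => bundleMap_mem (by omega) hs) hα
  have hdφ : contr b (presForm k n m) φα = 0 := by
    rw [hform, hφα, ← rTensor_contr b (bundleMap k n).toLinearMap (u := fun μ => monomial μ.1 1)
      (fun i r => map_mul (bundleMap k n) _ _), hdα, map_zero]
  obtain ⟨⟨β₀, β₁, γ⟩, hz', h⟩ := H (φα, φα, 0) ⟨gr_mono (laurentForms_mono fun i hi => hi.1) hφ,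
    gr_mono (laurentForms_mono fun i hi => by
      simp only [Set.mem_Icc, Set.mem_Iic] at *
      omega) hφ, zero_mem _⟩ (by
      rw [coneD_apply]
      simp only [hdφ, sub_self, map_zero]
      exact zero_mem _)
  obtain ⟨hβ₀, hβ₁, hγ⟩ := mem_coneZ.1 hz'
  simp only at hβ₀ hβ₁ hγ
  have h0 : ((φα, φα, 0) : KoszulSpace k (Laurent k n) V × KoszulSpace k (Laurent k n) V ×
      KoszulSpace k (Laurent k n) V) = coneD b (presForm k n m) (β₀, β₁, γ) := by
    rw [← sub_eq_zero]
    simpa [imageSum] using h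
  rw [coneD_apply] at h0
  have h1 : φα = contr b (presForm k n m) β₀ := congrArg Prod.fst h0
  have h3 : 0 = β₀ - β₁ - contr b (presForm k n m) γ := congrArg (fun z => z.2.2) h0
  set γ₀ := (tProj k n (Set.Ici 0)).rTensor (ExteriorAlgebra k V) γ with hγ₀
  have hγ₀_mem : γ₀ ∈ gr (V := V) (p + 1 + 1)
      (laurentForms k n (a - (m + 1 : ℕ) - (m + 1 : ℕ)) (Set.Ici 0)) :=
    rTensor_mem_gr _ (fun s hs => laurentForms_mono Set.inter_subset_left (tProj_mem _ _ hs)) hγ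
  have hγ₁_mem : γ - γ₀ ∈ gr (V := V) (p + 1 + 1)
      (laurentForms k n (a - (m + 1 : ℕ) - (m + 1 : ℕ)) (Set.Iic (-1))) := by
    have : γ - γ₀ = (LinearMap.id - tProj k n (Set.Ici 0)).rTensor (ExteriorAlgebra k V) γ := by
      rw [LinearMap.rTensor_sub, LinearMap.rTensor_id]
      rfl
    rw [this]
    refine rTensor_mem_gr _ (fun s hs => laurentForms_mono (fun i hi => ?_)
      (sub_tProj_mem _ _ hs)) hγ
    have : ¬ (0 : ℤ) ≤ i := hi.2
    exact Set.mem_Iic.2 (by omega)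
  have hmem : β₀ - contr b (presForm k n m) γ₀ ∈ gr (V := V) (p + 1)
      (laurentForms k n (a - (m + 1 : ℕ)) (Set.Ico 0 (a - (m + 1 : ℕ) + n))) := by
    have hd₀ := contr_mem_gr_laurent b (P' := Set.Ici 0) presForm_mem
      (add_sub_cancel ((m + 1 : ℕ) : ℤ) (a - (m + 1 : ℕ))) (fun i hi j hj => by
        simp only [Set.mem_Icc, Set.mem_Ici] at *
        omega) hγ₀_mem
    have hd₁ := contr_mem_gr_laurent b (P' := Set.Iic (a - (m + 1 : ℕ) + (n - 1))) presForm_mem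
      (add_sub_cancel ((m + 1 : ℕ) : ℤ) (a - (m + 1 : ℕ))) (fun i hi j hj => by
        simp only [Set.mem_Icc, Set.mem_Iic] at *
        omega) hγ₁_mem
    rw [add_sub_cancel_right] at hd₀ hd₁
    have heq : β₀ - contr b (presForm k n m) γ₀ = β₁ + contr b (presForm k n m) (γ - γ₀) := by
      rw [map_sub]
      have : β₀ = β₁ + contr b (presForm k n m) γ := by
        rw [← sub_eq_iff_eq_add', ← sub_eq_zero]
        exact h3.symm
      rw [this]
      abel
    have h4 := mem_gr_inter (sub_mem hβ₀ hd₀) (heq ▸ add_mem hβ₁ hd₁)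
    refine gr_mono (laurentForms_mono fun i hi => ?_) h4
    simp only [Set.mem_inter_iff, Set.mem_Ici, Set.mem_Iic, Set.mem_Ico] at *
    omega
  refine exists_contr_eq_of_bundle b hn (by omega) hmem ?_
  rw [← hform, map_sub, contr_contr, sub_zero, ← h1]

end Descent

section Induction

universe u

variable {k V : Type u} [Field k] [AddCommGroup V] [Module k V]

theorem forms_add_le {N : ℕ} (d : ℕ) {c : ℤ} (hc : 0 ≤ c)
    {P : Submodule k (MvPolynomial (Fin N) k)}
    (h : ∀ μ : Exponent N d, ∀ f ∈ forms k N c, monomial μ.1 1 * f ∈ P) :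
    forms k N (d + c) ≤ P := by
  induction d generalizing P with
  | zero =>
    intro f hf
    simpa using h ⟨0, map_zero _⟩ f (by simpa using hf)
  | succ d ih =>
    rw [show ((d + 1 : ℕ) : ℤ) + c = d + c + 1 by push_cast; ring]
    refine forms_succ_le (by omega) fun i f hf => ?_
    have := ih (P := P.comap (LinearMap.mulLeft k (X i))) fun μ g hg => ?_
    · exact this hf
    · rw [Submodule.mem_comap, LinearMap.mulLeft_apply, ← mul_assoc, X, monomial_mul, one_mul]
      exact h ⟨Finsupp.single i 1 + μ.1, by rw [map_add, Finsupp.degree_single, μ.2, add_comm]⟩ g hg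

theorem koszulExact_of_neg {N : ℕ} {J : Type*} [Fintype J] (b : Module.Basis J k V)
    (v : J → MvPolynomial (Fin N) k) {δ p a : ℤ} (hp : p < 0) : KoszulExact b v δ p a := by
  intro α hα _
  rw [gr_of_neg hp, Submodule.mem_bot] at hα
  exact ⟨0, zero_mem _, by rw [hα, map_zero]⟩

theorem koszulExact_zero {N d : ℕ} (b : Module.Basis (Exponent N d) k V) {c : ℤ} (hc : 0 ≤ c) :
    KoszulExact b (fun μ => monomial μ.1 1) d 0 (d + c) := by
  classical
  intro α hα _
  suffices forms k N (d + c) ≤ ((gr (V := V) (0 + 1) (forms k N c)).map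
      ((contr b fun μ => monomial μ.1 1).restrictScalars k)).comap
      ((TensorProduct.mk k (MvPolynomial (Fin N) k) (ExteriorAlgebra k V)).flip 1) by
    have h : gr (V := V) 0 (forms k N (d + c)) ≤ (gr (0 + 1) (forms k N c)).map
        ((contr b fun μ => monomial μ.1 1).restrictScalars k) := by
      refine gr_zero_le fun r hr => ?_
      have := this hr
      rwa [Submodule.mem_comap, LinearMap.flip_apply, TensorProduct.mk_apply, ← mul_one r,
        ← smul_eq_mul, ← TensorProduct.smul_tmul', ← Algebra.TensorProduct.one_def] at this
    rw [add_sub_cancel_left]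
    exact h hα
  refine forms_add_le d hc fun μ f hf => ?_
  refine ⟨vec b (Pi.single μ 1) * f ⊗ₜ 1, vec_mul_mem_gr b (fun i s hs => ?_)
    (tmul_mem_gr hf (by rw [extPiece_zero]; exact Submodule.one_le.1 le_rfl)), ?_⟩
  · rw [Pi.single_apply, ite_mul, one_mul, zero_mul]
    split_ifs
    · exact hs
    · exact zero_mem _
  · rw [LinearMap.restrictScalars_apply, contr_vec_mul]
    have : (f ⊗ₜ[k] 1 : KoszulSpace k (MvPolynomial (Fin N) k) V) = f • 1 := by
      rw [Algebra.TensorProduct.one_def, TensorProduct.smul_tmul', smul_eq_mul, mul_one]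
    rw [this, map_smul, contr_one, smul_zero, mul_zero, sub_zero, LinearMap.flip_apply,
      TensorProduct.mk_apply, smul_smul, Finset.sum_eq_single μ]
    · rw [Pi.single_eq_same, mul_one, Algebra.TensorProduct.one_def, TensorProduct.smul_tmul',
        smul_eq_mul, mul_one]
    · intro ν _ h
      rw [Pi.single_eq_of_ne h, mul_zero]
    · exact fun h => absurd (Finset.mem_univ _) h

theorem koszulExact_one {d : ℕ} (b : Module.Basis (Exponent 1 d) k V) (p : ℤ) {c : ℤ}
    (hc : 0 ≤ c) : KoszulExact b (fun μ => monomial μ.1 1) d p (d + c) := by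
  intro α hα hdα
  have hμ : ∀ μ : Exponent 1 d, μ.1 = Finsupp.single 0 d := by
    intro μ
    refine Finsupp.ext fun i => ?_
    have h := μ.2
    rw [Finsupp.degree_eq_sum] at h
    rw [Subsingleton.elim i 0]
    simpa using h
  have h1 : gr (V := V) p (forms k 1 (d + c)) ≤ (gr p (forms k 1 c)).map
      ((LinearMap.mulLeft k (monomial (Finsupp.single 0 d) 1)).rTensor (ExteriorAlgebra k V)) := by
    have : forms k 1 (d + c) ≤
        (forms k 1 c).map (LinearMap.mulLeft k (monomial (Finsupp.single 0 d) 1)) :=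
      forms_add_le d hc fun μ f hf => ⟨f, hf, by rw [hμ μ]; rfl⟩
    refine (gr_mono this).trans (gr_le.2 ?_)
    rintro _ ⟨g, hg, rfl⟩ y hy
    exact ⟨g ⊗ₜ y, tmul_mem_gr hg hy, LinearMap.rTensor_tmul _ _ _ _⟩
  obtain ⟨α', hα', rfl⟩ := h1 hα
  have hdα' : contr b (fun μ : Exponent 1 d => monomial μ.1 (1 : k)) α' = 0 := by
    refine Module.Flat.rTensor_preserves_injective_linearMap (M := ExteriorAlgebra k V)
      (LinearMap.mulLeft k (monomial (Finsupp.single (0 : Fin 1) d) (1 : k)))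
      (mul_right_injective₀ (by simp)) ?_
    rw [rTensor_contr b _ (u' := fun μ : Exponent 1 d => monomial μ.1 (1 : k))
      (fun i r => mul_left_comm _ _ _), hdα, map_zero]
  let μ₀ : Exponent 1 d := ⟨Finsupp.single 0 d, Finsupp.degree_single _ _⟩
  have : Subsingleton (Exponent 1 d) := ⟨fun μ ν => Subtype.ext ((hμ μ).trans (hμ ν).symm)⟩
  refine ⟨vec b 1 * α', ?_, ?_⟩
  · rw [add_sub_cancel_left]
    exact vec_mul_mem_gr b (fun i s hs => by rwa [Pi.one_apply, one_mul]) hα'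
  · rw [contr_vec_mul, hdα', mul_zero, sub_zero, Fintype.sum_subsingleton _ μ₀, Pi.one_apply,
      mul_one]
    rfl

theorem koszulExact_of_factorial_mul_le (n m : ℕ)
    (b : Module.Basis (Exponent (n + 1) (m + 1)) k V) {q : ℕ} (hq : 1 ≤ q) {p : ℤ}
    (h : p ≤ 0 ∨ n = 0 ∨ 2 ≤ q ∧ (n.factorial : ℤ) * p ≤ ((m + 1 : ℕ) : ℤ) ^ (q - 1)) :
    KoszulExact b (fun μ => monomial μ.1 1) (m + 1 : ℕ) p (q * (m + 1 : ℕ)) := by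
  induction n generalizing V q p with
  | zero =>
    obtain ⟨q, rfl⟩ := Nat.exists_eq_add_of_le hq
    have := koszulExact_one b p (c := q * (m + 1 : ℕ)) (by positivity)
    convert this using 1
    push_cast
    ring
  | succ n ih =>
    rcases lt_trichotomy p 0 with hp | rfl | hp
    · exact koszulExact_of_neg b _ hp
    · obtain ⟨q, rfl⟩ := Nat.exists_eq_add_of_le hq
      have := koszulExact_zero b (c := q * (m + 1 : ℕ)) (by positivity)
      convert this using 1
      push_cast
      ring
    obtain ⟨hq2, h⟩ : 2 ≤ q ∧ ((n + 1).factorial : ℤ) * p ≤ ((m + 1 : ℕ) : ℤ) ^ (q - 1) := by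
      rcases h with h | h | h
      · omega
      · omega
      · exact h
    obtain ⟨δ, hδ⟩ : ∃ δ, ((m + 1 : ℕ) : ℤ) = δ := ⟨_, rfl⟩
    rw [hδ] at h
    have hδ1 : 1 ≤ δ := by omega
    have hfac : ((n + 1).factorial : ℤ) = (n + 1) * n.factorial := by
      rw [Nat.factorial_succ]
      push_cast
      ring
    have hn1 : (1 : ℤ) ≤ n.factorial := by exact_mod_cast n.factorial_pos
    obtain ⟨q, rfl⟩ := Nat.exists_eq_add_of_le hq2
    refine koszulExact_of_exactMod b (Nat.succ_pos n) ?_ (exactMod_empty b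
      (Pi.basisFun k (Exponent (n + 1) (m + 1)))
      (P := fun p' c => ∃ i : ℕ, p' = p - i ∧ c = n - (n + 1) * i) ?_ ?_ ?_)
    · push_cast
      nlinarith
    · rintro _ _ ⟨i, rfl, rfl⟩
      refine ⟨i + 1, ?_, ?_⟩ <;> push_cast <;> ring
    · rintro _ _ ⟨i, rfl, rfl⟩
      refine ⟨ih _ (by omega) (Or.inr (Or.inr ⟨by omega, ?_⟩)), ?_⟩
      · rw [hδ]
        refine le_trans ?_ h
        rw [hfac]
        have : 0 ≤ (n.factorial : ℤ) * i := by positivity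
        have : 0 ≤ (n : ℤ) * (n.factorial * p) := by positivity
        linarith
      · by_cases hP : p - i + 1 ≤ 0 ∨ n = 0 ∨ 2 ≤ 1 + q ∧
            (n.factorial : ℤ) * (p - i + 1) ≤ ((m + 1 : ℕ) : ℤ) ^ (1 + q - 1)
        · left
          have := ih (Pi.basisFun k (Exponent (n + 1) (m + 1))) (q := 1 + q) (by omega) hP
          convert this using 1
          push_cast
          ring
        · right
          rw [hδ] at hP ⊢
          push Not at hP
          obtain ⟨hP1, hn0, hP2⟩ := hP
          have hi : (i : ℤ) ≤ p := by omega
          have hpi : 0 ≤ (p - i) * δ := by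
            have : 0 ≤ p - i := by omega
            positivity
          rcases Nat.eq_zero_or_pos q with rfl | hq0
          · have h5 : (n + 1) * (i : ℤ) ≤ (n + 1) * p := by nlinarith
            have h6 : (n + 1) * p ≤ (n + 1) * (n.factorial * p) :=
              mul_le_mul_of_nonneg_left (show p ≤ n.factorial * p by nlinarith)
                (show (0 : ℤ) ≤ n + 1 by omega)
            have h7 : (n + 1) * (n.factorial * p) ≤ δ := by
              rw [hfac] at h
              simpa [mul_assoc] using h
            push_cast
            nlinarith
          · have h4 := hP2 (by omega)
            rw [hfac, show 2 + q - 1 = (1 + q - 1) + 1 by omega, pow_succ] at h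
            have h5 : (n.factorial : ℤ) * ((n + 1) * i) < n.factorial * ((p - i + 1) * δ) := by
              have h8 : (n + 1) * (i : ℤ) ≤ (n + 1) * p := by nlinarith
              have h9 : (n.factorial : ℤ) * ((n + 1) * i) ≤ n.factorial * ((n + 1) * p) :=
                mul_le_mul_of_nonneg_left h8 (by omega)
              have h10 := mul_lt_mul_of_pos_right h4 (show 0 < δ by omega)
              linarith
            have h6 := lt_of_mul_lt_mul_left h5 (by omega)
            push_cast
            have h7 : 0 ≤ (q : ℤ) * δ := by positivity
            nlinarith
    · exact ⟨0, by simp, by push_cast; ring⟩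

end Induction

section Comparison

variable {k V R : Type*} [Field k] [AddCommGroup V] [Module k V] [CommRing R] [Algebra k R]

theorem omitFun_eq_succAbove {α : Type*} {p : ℕ} (v : Fin (p + 1) → α) (i : Fin (p + 1)) :
    omitFun v i = fun j : Fin p => v (i.succAbove j) := by
  funext j
  simp only [omitFun, Fin.succAbove, Fin.lt_def, Fin.val_castSucc]
  split_ifs <;> rfl

theorem contractLeft_ιMulti (u : Module.Dual k V) {p : ℕ} (v : Fin (p + 1) → V) :
    CliffordAlgebra.contractLeft (Q := (0 : QuadraticForm k V)) u
        (ExteriorAlgebra.ιMulti k (p + 1) v) =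
      ∑ i : Fin (p + 1), ((-1 : k) ^ (i : ℕ) * u (v i)) •
        ExteriorAlgebra.ιMulti k p (fun j => v (i.succAbove j)) := by
  induction p with
  | zero =>
    rw [ExteriorAlgebra.ιMulti_succ_apply, ExteriorAlgebra.ιMulti_zero_apply]
    have := CliffordAlgebra.contractLeft_ι_mul (Q := (0 : QuadraticForm k V)) (d := u) (v 0) 1
    refine this.trans ?_
    rw [CliffordAlgebra.contractLeft_one, mul_zero, sub_zero]
    simp
  | succ p ih =>
    rw [ExteriorAlgebra.ιMulti_succ_apply]
    have := CliffordAlgebra.contractLeft_ι_mul (Q := (0 : QuadraticForm k V)) (d := u) (v 0)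
      (ExteriorAlgebra.ιMulti k (p + 1) (Matrix.vecTail v))
    refine this.trans ?_
    rw [ih, Fin.sum_univ_succ (n := p + 1), sub_eq_add_neg, Finset.mul_sum,
      ← Finset.sum_neg_distrib]
    congr 1
    · simp [Matrix.vecTail, Function.comp_def]
    · refine Finset.sum_congr rfl fun i _ => ?_
      rw [ExteriorAlgebra.ιMulti_succ_apply (v := fun j => v (i.succ.succAbove j))]
      have h1 : (Matrix.vecTail fun j => v (i.succ.succAbove j)) =
          fun j => Matrix.vecTail v (i.succAbove j) := by
        funext j
        simp [Matrix.vecTail, Fin.succ_succAbove_succ]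
      rw [h1, mul_smul_comm, ← neg_smul, Fin.succ_succAbove_zero, Fin.val_succ, pow_succ]
      congr 1
      simp [Matrix.vecTail]

/-- The inclusion of `⋀^p V ⊗ S` into `R ⊗ ⋀ V`, where `S ⊆ R`. -/
def embed (p : ℕ) (S : Submodule k R) : (⋀[k]^p V) ⊗[k] S →ₗ[k] KoszulSpace k R V :=
  TensorProduct.map S.subtype (⋀[k]^p V).subtype ∘ₗ (TensorProduct.comm k _ _).toLinearMap

theorem embed_tmul {p : ℕ} {S : Submodule k R} (x : ⋀[k]^p V) (f : S) :
    embed p S (x ⊗ₜ f) = (f : R) ⊗ₜ (x : ExteriorAlgebra k V) := rfl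

theorem embed_injective (p : ℕ) (S : Submodule k R) :
    Function.Injective (embed (V := V) p S) := by
  rw [embed, LinearMap.coe_comp, LinearEquiv.coe_coe]
  refine Function.Injective.comp ?_ (LinearEquiv.injective _)
  rw [← LinearMap.rTensor_comp_lTensor, LinearMap.coe_comp]
  exact (Module.Flat.rTensor_preserves_injective_linearMap _ S.injective_subtype).comp
    (Module.Flat.lTensor_preserves_injective_linearMap _ (Submodule.injective_subtype _))

theorem range_embed (p : ℕ) (S : Submodule k R) :
    LinearMap.range (embed (V := V) p S) = gr p S := by
  apply le_antisymm
  · rintro _ ⟨x, rfl⟩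
    induction x using TensorProduct.induction_on with
    | zero => rw [map_zero]; exact zero_mem _
    | add x y hx hy => rw [map_add]; exact add_mem hx hy
    | tmul x f => exact tmul_mem_gr f.2 (by rw [extPiece_natCast]; exact x.2)
  · refine gr_le.2 fun r hr x hx => ?_
    rw [extPiece_natCast] at hx
    exact ⟨⟨x, hx⟩ ⊗ₜ ⟨r, hr⟩, rfl⟩

theorem span_wedge (p : ℕ) : Submodule.span k (Set.range (wedge k (M := V) p)) = ⊤ := by
  refine Submodule.map_injective_of_injective (Submodule.injective_subtype (⋀[k]^p V)) ?_
  rw [Submodule.map_span, ← Set.range_comp, Submodule.map_top, Submodule.range_subtype]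
  exact ExteriorAlgebra.ιMulti_span_fixedDegree k p

theorem ext_wedge_tmul {p : ℕ} {S M : Type*} [AddCommMonoid S] [Module k S] [AddCommMonoid M]
    [Module k M] {f g : (⋀[k]^p V) ⊗[k] S →ₗ[k] M}
    (h : ∀ v s, f (wedge k p v ⊗ₜ s) = g (wedge k p v ⊗ₜ s)) : f = g := by
  refine TensorProduct.ext ?_
  refine LinearMap.ext_on_range (span_wedge p) fun v => ?_
  ext s
  exact h v s

theorem embed_koszulDifferential {J : Type*} [Fintype J] {W S S' : Submodule k R}
    (b : Module.Basis J k W) {p : ℕ} (mul : W → S → S')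
    (hmul : ∀ v f, (mul v f : R) = v * f)
    (δ : (⋀[k]^(p + 1) W) ⊗[k] S →ₗ[k] (⋀[k]^p W) ⊗[k] S')
    (hδ : ∀ (v : Fin (p + 1) → W) (f : S), δ (wedge k (p + 1) v ⊗ₜ f) =
      ∑ i : Fin (p + 1), (-1 : k) ^ (i : ℕ) • (wedge k p (omitFun v i) ⊗ₜ[k] mul (v i) f))
    (x : (⋀[k]^(p + 1) W) ⊗[k] S) :
    embed p S' (δ x) = contr b (fun i => (b i : R)) (embed (p + 1) S x) := by
  suffices embed p S' ∘ₗ δ =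
      (contr b fun i => (b i : R)).restrictScalars k ∘ₗ embed (p + 1) S from
    LinearMap.congr_fun this x
  refine ext_wedge_tmul fun v f => ?_
  rw [LinearMap.comp_apply, LinearMap.comp_apply, LinearMap.restrictScalars_apply, hδ, embed_tmul,
    contr_tmul, map_sum]
  have h (j : J) : CliffordAlgebra.contractLeft (Q := (0 : QuadraticForm k W)) (b.coord j)
      (wedge k (p + 1) v : ExteriorAlgebra k W) = _ := contractLeft_ιMulti (b.coord j) v
  simp only [h, TensorProduct.tmul_sum]
  rw [Finset.sum_comm]
  refine Finset.sum_congr rfl fun i _ => ?_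
  have hv : (v i : R) = ∑ j, b.repr (v i) j • (b j : R) := by
    conv_lhs => rw [← b.sum_repr (v i)]
    simp [-Module.Basis.sum_repr]
  rw [map_smul, embed_tmul, hmul, hv, Finset.sum_mul, TensorProduct.sum_tmul, Finset.smul_sum]
  refine Finset.sum_congr rfl fun j _ => ?_
  rw [smul_mul_assoc, ← TensorProduct.smul_tmul', smul_smul, TensorProduct.tmul_smul,
    omitFun_eq_succAbove]
  rfl

/-- The basis of monomials of the space of forms of degree `d` in `N` variables. -/
def monomialBasis (k : Type*) [Field k] (N d : ℕ) : Module.Basis (Exponent N d) k (forms k N d) :=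
  Module.Basis.mk
    (v := fun μ => ⟨monomial μ.1 1, by simpa [μ.2] using monomial_mem_forms μ.1 (1 : k)⟩)
    (by
      refine LinearIndependent.of_comp (forms k N d).subtype ?_
      have := (basisMonomials (Fin N) k).linearIndependent.comp
        (Subtype.val : Exponent N d → _) Subtype.val_injective
      rwa [coe_basisMonomials] at this)
    (by
      have h : forms k N d ≤ (Submodule.span k (Set.range fun μ : Exponent N d =>
          (⟨monomial μ.1 1, by simpa [μ.2] using monomial_mem_forms μ.1 (1 : k)⟩ :
            forms k N d))).map (forms k N d).subtype :=
        forms_le fun μ hμ => ⟨_, Submodule.subset_span ⟨⟨μ, by exact_mod_cast hμ⟩, rfl⟩, rfl⟩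
      rintro ⟨f, hf⟩ -
      obtain ⟨g, hg, rfl⟩ := h hf
      exact hg)

theorem monomialBasis_apply {N d : ℕ} (μ : Exponent N d) :
    (monomialBasis k N d μ : MvPolynomial (Fin N) k) = monomial μ.1 1 := by
  rw [monomialBasis, Module.Basis.mk_apply]

end Comparison
end VeroneseSyzygies

open VeroneseSyzygies

/-- **Asymptotic vanishing of Veronese syzygies.**
Let `𝕜` be an algebraically closed field, `n ≥ 1`, `d ≥ 1`.  For every `2 ≤ q ≤ n + 1`
and every `0 ≤ p` with `n!·p ≤ d^{q-1}`, the Koszul cohomology group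
`K_{p,q}(ℙ^n, O_{ℙ^n}(d))` vanishes, i.e. the Koszul-type complex
`⋀^{p+1}V ⊗ R_{q-1} → ⋀^{p}V ⊗ R_q → ⋀^{p-1}V ⊗ R_{q+1}` is exact at the middle term,
where `T = 𝕜[x_0,…,x_n]` is the standard graded polynomial ring, `V = T_d` and
`R_m = T_{m d}`. -/
theorem asymptotic_vanishing_syzygies_veronese
    (𝕜 : Type*) [Field 𝕜] [IsAlgClosed 𝕜]
    (n : ℕ) (hn : 1 ≤ n) (d : ℤ) (hd : 1 ≤ d)
    (q : ℕ) (hq2 : 2 ≤ q) (hqtop : q ≤ n + 1)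
    (p : ℕ) (hp : ((n.factorial : ℤ)) * (p : ℤ) ≤ d ^ (q - 1))
    -- the weight function giving the standard grading of `T = 𝕜[x_0, …, x_n]`
    (w : Fin (n + 1) → ℤ) (hw : ∀ x, w x = 1)
    -- the Koszul differential `δ_{p+1,q-1} : ⋀^{p+1} V ⊗ R_{q-1} → ⋀^p V ⊗ R_q`
    (δ₁ : ((⋀[𝕜]^(p + 1) (component 𝕜 w d)) ⊗[𝕜] (component 𝕜 w (((q : ℤ) - 1) * d))) →ₗ[𝕜]
        ((⋀[𝕜]^p (component 𝕜 w d)) ⊗[𝕜] (component 𝕜 w ((q : ℤ) * d))))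
    (hδ₁ : ∀ (v : Fin (p + 1) → (component 𝕜 w d))
        (f : component 𝕜 w (((q : ℤ) - 1) * d)),
        δ₁ (wedge 𝕜 (p + 1) v ⊗ₜ[𝕜] f) =
          ∑ i : Fin (p + 1), ((-1 : 𝕜) ^ (i : ℕ)) •
            (wedge 𝕜 p (omitFun v i) ⊗ₜ[𝕜] componentMul 𝕜 w (by ring) (v i) f))
    -- the Koszul differential `δ_{p,q} : ⋀^{p} V ⊗ R_q → ⋀^{p-1} V ⊗ R_{q+1}`
    (δ₂ : ((⋀[𝕜]^p (component 𝕜 w d)) ⊗[𝕜] (component 𝕜 w ((q : ℤ) * d))) →ₗ[𝕜]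
        ((⋀[𝕜]^(p - 1) (component 𝕜 w d)) ⊗[𝕜] (component 𝕜 w (((q : ℤ) + 1) * d))))
    (hδ₂ : ∀ (v : Fin p → (component 𝕜 w d)) (f : component 𝕜 w ((q : ℤ) * d)),
        δ₂ (wedge 𝕜 p v ⊗ₜ[𝕜] f) =
          ∑ i : Fin p, ((-1 : 𝕜) ^ (i : ℕ)) •
            (wedge 𝕜 (p - 1) (omitFun v i) ⊗ₜ[𝕜] componentMul 𝕜 w (by ring) (v i) f)) :
    LinearMap.range δ₁ = LinearMap.ker δ₂ := by
  obtain rfl : w = fun _ => 1 := funext hw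
  lift d to ℕ using by omega
  obtain ⟨m, rfl⟩ : ∃ m, d = m + 1 := ⟨d - 1, by omega⟩
  have h₁ := embed_koszulDifferential (monomialBasis 𝕜 (n + 1) (m + 1))
    (componentMul 𝕜 _ (by ring)) (fun _ _ => rfl) δ₁ hδ₁
  have h₂ (x) (hx : δ₂ x = 0) :
      contr (monomialBasis 𝕜 (n + 1) (m + 1))
        (fun i => (monomialBasis 𝕜 (n + 1) (m + 1) i : MvPolynomial (Fin (n + 1)) 𝕜))
        (embed p _ x) = 0 := by
    cases p with
    | zero =>
      have hmem := contr_mem_gr (monomialBasis 𝕜 (n + 1) (m + 1)) (S' := ⊤)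
        (u := fun i => (monomialBasis 𝕜 (n + 1) (m + 1) i : MvPolynomial (Fin (n + 1)) 𝕜))
        (fun _ _ _ => Submodule.mem_top) ((range_embed 0 _).le (LinearMap.mem_range_self _ x))
      rwa [gr_of_neg (by simp), Submodule.mem_bot] at hmem
    | succ p =>
      rw [← embed_koszulDifferential (p := p) _ (componentMul 𝕜 _ (by ring)) (fun _ _ => rfl)
        δ₂ hδ₂, hx, map_zero]
  apply le_antisymm
  · rintro _ ⟨y, rfl⟩
    rw [LinearMap.mem_ker]
    cases p with
    | zero =>
      have : δ₂ = 0 := ext_wedge_tmul fun v f => by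
        rw [hδ₂, Fin.sum_univ_zero, LinearMap.zero_apply]
      rw [this, LinearMap.zero_apply]
    | succ p =>
      refine embed_injective p _ ?_
      rw [embed_koszulDifferential (p := p) (monomialBasis 𝕜 (n + 1) (m + 1))
        (componentMul 𝕜 _ (by ring)) (fun _ _ => rfl) δ₂ hδ₂, h₁, contr_contr, map_zero]
  · intro x hx
    have hexact := koszulExact_of_factorial_mul_le n m (monomialBasis 𝕜 (n + 1) (m + 1))
      (q := q) (by omega) (p := p) (Or.inr (Or.inr ⟨hq2, hp⟩))
    simp only [← monomialBasis_apply] at hexact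
    obtain ⟨β, hβ, h⟩ := hexact _ ((range_embed p _).le (LinearMap.mem_range_self _ x))
      (h₂ x hx)
    rw [show (q : ℤ) * (m + 1 : ℕ) - (m + 1 : ℕ) = (q - 1) * (m + 1 : ℕ) by ring,
      ← Nat.cast_succ, ← range_embed] at hβ
    obtain ⟨y, rfl⟩ := hβ
    exact ⟨y, embed_injective p _ (by rw [h₁, h])⟩

end
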